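/- For every labelled linear ordering M = (ℤ, <, P₁, …, Pₙ) there exists a set Q ⊆ ℤ such that Q is not MSO-definable in M and the MSO theory of the expansion M' = (ℤ, <, P₁, …, Pₙ, Q) is recursive in (Turing reducible to) the MSO theory of M. In particular, if MSO(M) is decidable, then MSO(M') is decidable. -/

import Mathlib

namespace Paper

/-! ## Syntax and semantics of monadic second-order logic over labelled linear orders

A labelled linear ordering `M = (A, <, P₁, …, Pₙ)` is represented by a type `A`,
a binary relation `r : A → A → Prop` (the order) and `P : Fin n → Set A`
(the unary predicates). -/

/-- MSO formulas over the signature `{<, P₀, …, P_{n-1}}`.  First-order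
variables and second-order (set) variables are both indexed by `ℕ`. -/
inductive MSO (n : ℕ) : Type
  | lt (i j : ℕ) : MSO n
  | pred (k : Fin n) (i : ℕ) : MSO n
  | mem (i j : ℕ) : MSO n
  | not (φ : MSO n) : MSO n
  | and (φ ψ : MSO n) : MSO n
  | ex1 (i : ℕ) (φ : MSO n) : MSO n
  | ex2 (j : ℕ) (φ : MSO n) : MSO n

namespace MSO

variable {n : ℕ}

/-- Satisfaction of an MSO formula in the structure `(A, r, P)` under the
first-order assignment `v` and the second-order assignment `V`. -/
def Sat {A : Type} (r : A → A → Prop) (P : Fin n → Set A)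
    (v : ℕ → A) (V : ℕ → Set A) : MSO n → Prop
  | lt i j => r (v i) (v j)
  | pred k i => v i ∈ P k
  | mem i j => v i ∈ V j
  | not φ => ¬ Sat r P v V φ
  | and φ ψ => Sat r P v V φ ∧ Sat r P v V ψ
  | ex1 i φ => ∃ a : A, Sat r P (Function.update v i a) V φ
  | ex2 j φ => ∃ S : Set A, Sat r P v (Function.update V j S) φ

/-- Quantifier depth of an MSO formula. -/
def qd : MSO n → ℕ
  | lt _ _ => 0
  | pred _ _ => 0
  | mem _ _ => 0
  | not φ => qd φ
  | and φ ψ => max (qd φ) (qd ψ)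
  | ex1 _ φ => qd φ + 1
  | ex2 _ φ => qd φ + 1

/-- Free first-order variables of an MSO formula. -/
def fv1 : MSO n → Finset ℕ
  | lt i j => {i, j}
  | pred _ i => {i}
  | mem i _ => {i}
  | not φ => fv1 φ
  | and φ ψ => fv1 φ ∪ fv1 ψ
  | ex1 i φ => fv1 φ \ {i}
  | ex2 _ φ => fv1 φ

/-- Free second-order variables of an MSO formula. -/
def fv2 : MSO n → Finset ℕ
  | lt _ _ => ∅
  | pred _ _ => ∅
  | mem _ j => {j}
  | not φ => fv2 φ
  | and φ ψ => fv2 φ ∪ fv2 ψ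
  | ex1 _ φ => fv2 φ
  | ex2 j φ => fv2 φ \ {j}

/-- A sentence is a formula with no free variables. -/
def IsSentence (φ : MSO n) : Prop := fv1 φ = ∅ ∧ fv2 φ = ∅

/-- A sentence `φ` is true in the structure `(A, r, P)`. -/
def TrueIn {A : Type} (r : A → A → Prop) (P : Fin n → Set A) (φ : MSO n) : Prop :=
  ∀ (v : ℕ → A) (V : ℕ → Set A), Sat r P v V φ

/-- `Q ⊆ A` is MSO-definable in `(A, r, P)`: there is a formula `φ(x)` whose only
free variable is the first-order variable `0` defining `Q`. -/
def Definable {A : Type} (r : A → A → Prop) (P : Fin n → Set A) (Q : Set A) : Prop :=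
  ∃ φ : MSO n, fv1 φ ⊆ {0} ∧ fv2 φ = ∅ ∧
    ∀ a : A, a ∈ Q ↔ ∀ (v : ℕ → A) (V : ℕ → Set A), Sat r P (Function.update v 0 a) V φ

/-- A Gödel numbering of MSO formulas. -/
def encode : MSO n → ℕ
  | lt i j => Nat.pair 0 (Nat.pair i j)
  | pred k i => Nat.pair 1 (Nat.pair k i)
  | mem i j => Nat.pair 2 (Nat.pair i j)
  | not φ => Nat.pair 3 (encode φ)
  | and φ ψ => Nat.pair 4 (Nat.pair (encode φ) (encode ψ))
  | ex1 i φ => Nat.pair 5 (Nat.pair i (encode φ))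
  | ex2 j φ => Nat.pair 6 (Nat.pair j (encode φ))

/-- The MSO theory of the structure `(A, r, P)`, as a set of Gödel codes of the true
sentences. -/
def TheoryCodes {A : Type} (r : A → A → Prop) (P : Fin n → Set A) : Set ℕ :=
  {c | ∃ φ : MSO n, IsSentence φ ∧ encode φ = c ∧ TrueIn r P φ}

/-- Two structures have the same `k`-type: they satisfy the same MSO sentences of
quantifier depth `≤ k`. -/
def EquivType (k : ℕ) {A B : Type} (r : A → A → Prop) (P : Fin n → Set A)
    (s : B → B → Prop) (Q : Fin n → Set B) : Prop :=
  ∀ φ : MSO n, IsSentence φ → qd φ ≤ k → (TrueIn r P φ ↔ TrueIn s Q φ)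

/-- The `k`-type of a structure, as the set of Gödel codes of the true sentences
of quantifier depth `≤ k`. -/
def TypeSet (k : ℕ) {A : Type} (r : A → A → Prop) (P : Fin n → Set A) : Set ℕ :=
  {c | ∃ φ : MSO n, IsSentence φ ∧ qd φ ≤ k ∧ encode φ = c ∧ TrueIn r P φ}

end MSO

/-- The order relation of the substructure with domain `S`. -/
def subRel {A : Type} (r : A → A → Prop) (S : Set A) : S → S → Prop :=
  fun x y => r x y

/-- The predicates of the substructure with domain `S`. -/
def subPred {A : Type} {n : ℕ} (P : Fin n → Set A) (S : Set A) : Fin n → Set S :=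
  fun k => {x : S | (x : A) ∈ P k}

/-! ## Relative computability -/

/-- Partial recursiveness relative to an oracle `O` (Kleene-style, following
the definition of `Nat.Partrec`, with an extra base case for the oracle). -/
inductive RecursiveIn (O : ℕ →. ℕ) : (ℕ →. ℕ) → Prop
  | zero : RecursiveIn O (pure 0)
  | succ : RecursiveIn O ↑Nat.succ
  | left : RecursiveIn O ↑fun n : ℕ => n.unpair.1
  | right : RecursiveIn O ↑fun n : ℕ => n.unpair.2
  | oracle : RecursiveIn O O
  | pair {f g} : RecursiveIn O f → RecursiveIn O g →
      RecursiveIn O fun n => Nat.pair <$> f n <*> g n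
  | comp {f g} : RecursiveIn O f → RecursiveIn O g →
      RecursiveIn O fun n => g n >>= f
  | prec {f g} : RecursiveIn O f → RecursiveIn O g →
      RecursiveIn O (Nat.unpaired fun a m =>
        m.rec (f a) fun y IH => do let i ← IH; g (Nat.pair a (Nat.pair y i)))
  | rfind {f} : RecursiveIn O f →
      RecursiveIn O fun a => Nat.rfind fun m => (fun x => x = 0) <$> f (Nat.pair a m)

/-- The characteristic (partial) function of a set of naturals. -/
noncomputable def chi (S : Set ℕ) : ℕ →. ℕ :=
  fun m => Part.some (S.indicator (fun _ => 1) m)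

/-- `S` is recursive in (Turing reducible to) `T`. -/
def TuringRed (S T : Set ℕ) : Prop := RecursiveIn (chi T) (chi S)

/-- The (recursive) join of a finite family of sets of naturals. -/
def finJoin {m : ℕ} (P : Fin m → Set ℕ) : Set ℕ :=
  {c | ∃ i : Fin m, ∃ x : ℕ, c = Nat.pair i x ∧ x ∈ P i}

/-- The (recursive) join of two sets of naturals. -/
def setJoin (S T : Set ℕ) : Set ℕ :=
  {c | (∃ a, c = 2 * a ∧ a ∈ S) ∨ (∃ a, c = 2 * a + 1 ∧ a ∈ T)}

/-- A set of naturals is decidable (computable). -/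
def DecidableSet (S : Set ℕ) : Prop := ComputablePred (· ∈ S)

/-! ## Homogeneous sets for labelled orderings of the naturals -/

/-- `H = {h 0 < h 1 < ⋯}` is `k`-homogeneous for `(ℕ, <, P)`:
all substructures `M_{[h i, h j)}`, `i < j`, have the same `k`-type. -/
def KHomogeneous {n : ℕ} (P : Fin n → Set ℕ) (h : ℕ → ℕ) (k : ℕ) : Prop :=
  ∀ i j i' j' : ℕ, i < j → i' < j' →
    MSO.EquivType k
      (subRel (· < ·) (Set.Ico (h i) (h j))) (subPred P (Set.Ico (h i) (h j)))
      (subRel (· < ·) (Set.Ico (h i') (h j'))) (subPred P (Set.Ico (h i') (h j')))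

/-- `H = {h 0 < h 1 < ⋯}` is uniformly homogeneous for `(ℕ, <, P)`:
for each `k`, the set `{h k < h (k+1) < ⋯}` is `k`-homogeneous. -/
def UniformlyHomogeneous {n : ℕ} (P : Fin n → Set ℕ) (h : ℕ → ℕ) : Prop :=
  StrictMono h ∧
  ∀ k : ℕ, KHomogeneous P (fun i => h (k + i)) k

/-! ## ℤ-words -/

/-- The finite word `u` occurs at position `i` in the `ℤ`-word `w`. -/
def OccursAt {σ : Type} (w : ℤ → σ) (u : List σ) (i : ℤ) : Prop :=
  ∀ k : Fin u.length, w (i + (k : ℕ)) = u.get k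

/-- The finite word `u` occurs in the `ℤ`-word `w`. -/
def OccursIn {σ : Type} (w : ℤ → σ) (u : List σ) : Prop :=
  ∃ i : ℤ, OccursAt w u i

/-- `u` occurs in every prefix of `w`. -/
def InEveryPrefix {σ : Type} (w : ℤ → σ) (u : List σ) : Prop :=
  ∀ n : ℤ, ∃ i : ℤ, i + u.length ≤ n ∧ OccursAt w u i

/-- `u` occurs in every suffix of `w`. -/
def InEverySuffix {σ : Type} (w : ℤ → σ) (u : List σ) : Prop :=
  ∀ n : ℤ, ∃ i : ℤ, n ≤ i ∧ OccursAt w u i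

/-- A `ℤ`-word `w` is recurrent: for every regular language `X`, either no element
of `X` occurs in `w`, or every prefix and every suffix of `w` contains an
occurrence of some element of `X`. -/
def Recurrent {σ : Type} (w : ℤ → σ) : Prop :=
  ∀ X : Language σ, X.IsRegular →
    (∀ u ∈ X, ¬ OccursIn w u) ∨
    (∀ n : ℤ, (∃ u ∈ X, ∃ i : ℤ, i + u.length ≤ n ∧ OccursAt w u i) ∧
              (∃ u ∈ X, ∃ i : ℤ, n ≤ i ∧ OccursAt w u i))

/-- The `ℤ`-word `w(M)` over the alphabet `{0,1}ⁿ` associated with the labelled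
linear ordering `M = (ℤ, <, P₁, …, Pₙ)`. -/
def wordOf {n : ℕ} (P : Fin n → Set ℤ) : ℤ → (Fin n → Prop) :=
  fun i k => i ∈ P k

end Paper

open Paper

namespace Paper

notation "ZSat" => MSO.Sat (fun x y : ℤ => x < y)

namespace MSO

variable {n : ℕ}

/-! ### Derived connectives and dependence on free variables -/

/-- Disjunction. -/
protected def or (φ ψ : MSO n) : MSO n := .not (.and (.not φ) (.not ψ))

/-- Implication. -/
protected def imp (φ ψ : MSO n) : MSO n := .not (.and φ (.not ψ))

/-- Equivalence. -/
protected def iff (φ ψ : MSO n) : MSO n := .and (.imp φ ψ) (.imp ψ φ)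

/-- First-order universal quantification. -/
protected def all1 (i : ℕ) (φ : MSO n) : MSO n := .not (.ex1 i (.not φ))

/-- Second-order universal quantification. -/
protected def all2 (j : ℕ) (φ : MSO n) : MSO n := .not (.ex2 j (.not φ))

/-- The formula `xᵢ ≤ xⱼ`. -/
protected def le (i j : ℕ) : MSO n := .not (.lt j i)

section Derived

variable {A : Type} (r : A → A → Prop) (P : Fin n → Set A) (v : ℕ → A) (V : ℕ → Set A)

@[simp] theorem sat_or (φ ψ : MSO n) :
    Sat r P v V (.or φ ψ) ↔ Sat r P v V φ ∨ Sat r P v V ψ := by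
  simp only [MSO.or, Sat]; tauto

@[simp] theorem sat_imp (φ ψ : MSO n) :
    Sat r P v V (.imp φ ψ) ↔ (Sat r P v V φ → Sat r P v V ψ) := by
  simp only [MSO.imp, Sat]; tauto

@[simp] theorem sat_iff (φ ψ : MSO n) :
    Sat r P v V (.iff φ ψ) ↔ (Sat r P v V φ ↔ Sat r P v V ψ) := by
  simp only [MSO.iff, Sat, sat_imp]; tauto

@[simp] theorem sat_all1 (i : ℕ) (φ : MSO n) :
    Sat r P v V (.all1 i φ) ↔ ∀ a, Sat r P (Function.update v i a) V φ := by
  simp [MSO.all1, Sat]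

@[simp] theorem sat_all2 (j : ℕ) (φ : MSO n) :
    Sat r P v V (.all2 j φ) ↔ ∀ S, Sat r P v (Function.update V j S) φ := by
  simp [MSO.all2, Sat]

end Derived

@[simp] theorem sat_le (P : Fin n → Set ℤ) (v : ℕ → ℤ) (V : ℕ → Set ℤ) (i j : ℕ) :
    ZSat P v V (.le i j) ↔ v i ≤ v j := by
  simp [MSO.le, Sat]

theorem sat_congr {A : Type} (r : A → A → Prop) (P : Fin n → Set A) (φ : MSO n) :
    ∀ {v v' : ℕ → A} {V V' : ℕ → Set A}, (∀ i ∈ fv1 φ, v i = v' i) →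
      (∀ j ∈ fv2 φ, V j = V' j) → (Sat r P v V φ ↔ Sat r P v' V' φ) := by
  induction φ with
  | lt i j => intro v v' V V' h1 _; simp [Sat, h1 i (by simp [fv1]), h1 j (by simp [fv1])]
  | pred k i => intro v v' V V' h1 _; simp [Sat, h1 i (by simp [fv1])]
  | mem i j =>
    intro v v' V V' h1 h2; simp [Sat, h1 i (by simp [fv1]), h2 j (by simp [fv2])]
  | not φ ih => intro v v' V V' h1 h2; exact not_congr (ih h1 h2)
  | and φ ψ ih1 ih2 =>
    intro v v' V V' h1 h2
    exact and_congr
      (ih1 (fun i hi => h1 i (by simp [fv1, hi])) (fun i hi => h2 i (by simp [fv2, hi])))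
      (ih2 (fun i hi => h1 i (by simp [fv1, hi])) (fun i hi => h2 i (by simp [fv2, hi])))
  | ex1 i φ ih =>
    intro v v' V V' h1 h2
    refine exists_congr fun a => ih (fun k hk => ?_) h2
    by_cases e : k = i
    · subst e; simp
    · simp [e, h1 k (by simp [fv1, hk, e])]
  | ex2 j φ ih =>
    intro v v' V V' h1 h2
    refine exists_congr fun a => ih h1 (fun k hk => ?_)
    by_cases e : k = j
    · subst e; simp
    · simp [e, h2 k (by simp [fv2, hk, e])]

theorem le_encode_of_mem_fv1 (φ : MSO n) : ∀ i ∈ fv1 φ, i ≤ encode φ := by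
  induction φ with
  | lt i j =>
    intro k hk
    have := Nat.left_le_pair i j
    have := Nat.right_le_pair i j
    have := Nat.right_le_pair 0 (Nat.pair i j)
    simp only [fv1, Finset.mem_insert, Finset.mem_singleton] at hk
    simp only [encode]; omega
  | pred q i =>
    intro k hk
    have := Nat.right_le_pair q i
    have := Nat.right_le_pair 1 (Nat.pair q i)
    simp only [fv1, Finset.mem_singleton] at hk
    simp only [encode]; omega
  | mem i j =>
    intro k hk
    have := Nat.left_le_pair i j
    have := Nat.right_le_pair 2 (Nat.pair i j)
    simp only [fv1, Finset.mem_singleton] at hk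
    simp only [encode]; omega
  | not φ ih => exact fun k hk => (ih k hk).trans (Nat.right_le_pair _ _)
  | and φ ψ ih1 ih2 =>
    intro k hk
    simp only [fv1, Finset.mem_union] at hk
    rcases hk with hk | hk
    · exact ((ih1 k hk).trans (Nat.left_le_pair _ _)).trans (Nat.right_le_pair _ _)
    · exact ((ih2 k hk).trans (Nat.right_le_pair _ _)).trans (Nat.right_le_pair _ _)
  | ex1 i φ ih =>
    intro k hk
    simp only [fv1, Finset.mem_sdiff] at hk
    exact ((ih k hk.1).trans (Nat.right_le_pair _ _)).trans (Nat.right_le_pair _ _)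
  | ex2 j φ ih =>
    exact fun k hk => ((ih k hk).trans (Nat.right_le_pair _ _)).trans (Nat.right_le_pair _ _)

theorem le_encode_of_mem_fv2 (φ : MSO n) : ∀ i ∈ fv2 φ, i ≤ encode φ := by
  induction φ with
  | lt i j => simp [fv2]
  | pred q i => simp [fv2]
  | mem i j =>
    intro k hk
    simp only [fv2, Finset.mem_singleton] at hk
    subst hk
    exact (Nat.right_le_pair _ _).trans (Nat.right_le_pair _ _)
  | not φ ih => exact fun k hk => (ih k hk).trans (Nat.right_le_pair _ _)
  | and φ ψ ih1 ih2 =>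
    intro k hk
    simp only [fv2, Finset.mem_union] at hk
    rcases hk with hk | hk
    · exact ((ih1 k hk).trans (Nat.left_le_pair _ _)).trans (Nat.right_le_pair _ _)
    · exact ((ih2 k hk).trans (Nat.right_le_pair _ _)).trans (Nat.right_le_pair _ _)
  | ex1 i φ ih =>
    exact fun k hk => ((ih k hk).trans (Nat.right_le_pair _ _)).trans (Nat.right_le_pair _ _)
  | ex2 j φ ih =>
    intro k hk
    simp only [fv2, Finset.mem_sdiff] at hk
    exact ((ih k hk.1).trans (Nat.right_le_pair _ _)).trans (Nat.right_le_pair _ _)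

/-! ### Closing formulas by existential quantifiers -/

/-- Existential quantification of the first-order variables `k, …, k + m - 1`. -/
def closeFO (k : ℕ) : ℕ → MSO n → MSO n
  | 0, φ => φ
  | m + 1, φ => .ex1 (m + k) (closeFO k m φ)

/-- Existential quantification of the second-order variables `0, …, m - 1`. -/
def closeSO : ℕ → MSO n → MSO n
  | 0, φ => φ
  | m + 1, φ => .ex2 m (closeSO m φ)

/-- Existential quantification of all second-order variables and of all first-order
variables with index at least `k`. -/
def close (k : ℕ) (φ : MSO n) : MSO n :=
  closeSO (encode φ + 1) (closeFO k (encode φ + 1) φ)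

theorem mem_fv1_closeFO (k m : ℕ) (φ : MSO n) (i : ℕ) :
    i ∈ fv1 (closeFO k m φ) ↔ i ∈ fv1 φ ∧ ¬ (k ≤ i ∧ i < m + k) := by
  induction m with
  | zero => simp only [closeFO]; constructor
            · exact fun h => ⟨h, by omega⟩
            · exact fun h => h.1
  | succ m ih =>
    simp only [closeFO, fv1, Finset.mem_sdiff, ih, Finset.mem_singleton]
    constructor
    · rintro ⟨⟨h1, h2⟩, h3⟩; exact ⟨h1, by omega⟩
    · rintro ⟨h1, h2⟩; exact ⟨⟨h1, by omega⟩, by omega⟩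

theorem fv2_closeFO (k m : ℕ) (φ : MSO n) : fv2 (closeFO k m φ) = fv2 φ := by
  induction m with
  | zero => rfl
  | succ m ih => exact ih

theorem fv1_closeSO (m : ℕ) (φ : MSO n) : fv1 (closeSO m φ) = fv1 φ := by
  induction m with
  | zero => rfl
  | succ m ih => exact ih

theorem mem_fv2_closeSO (m : ℕ) (φ : MSO n) (i : ℕ) :
    i ∈ fv2 (closeSO m φ) ↔ i ∈ fv2 φ ∧ m ≤ i := by
  induction m with
  | zero => simp [closeSO]
  | succ m ih =>
    simp only [closeSO, fv2, Finset.mem_sdiff, ih, Finset.mem_singleton]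
    constructor
    · rintro ⟨⟨h1, h2⟩, h3⟩; exact ⟨h1, by omega⟩
    · rintro ⟨h1, h2⟩; exact ⟨⟨h1, by omega⟩, by omega⟩

theorem lt_of_mem_fv1_close {k : ℕ} {φ : MSO n} {i : ℕ} (hi : i ∈ fv1 (close k φ)) :
    i < k := by
  rw [close, fv1_closeSO, mem_fv1_closeFO] at hi
  have := le_encode_of_mem_fv1 φ i hi.1
  omega

@[simp] theorem fv2_close (k : ℕ) (φ : MSO n) : fv2 (close k φ) = ∅ := by
  ext i
  simp only [close, mem_fv2_closeSO, fv2_closeFO, Finset.notMem_empty, iff_false, not_and]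
  intro hi
  have := le_encode_of_mem_fv2 φ i hi
  omega

@[simp] theorem fv1_close_zero (φ : MSO n) : fv1 (close 0 φ) = ∅ := by
  ext i
  simp only [Finset.notMem_empty, iff_false]
  exact fun h => absurd (lt_of_mem_fv1_close h) (by omega)

theorem sat_close {A : Type} [Nonempty A] (r : A → A → Prop) (P : Fin n → Set A) (k : ℕ)
    (φ : MSO n) (h : ∀ (v v' : ℕ → A) (V V' : ℕ → Set A), (∀ i < k, v i = v' i) →
      (Sat r P v V φ ↔ Sat r P v' V' φ)) (v : ℕ → A) (V : ℕ → Set A) :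
    Sat r P v V (close k φ) ↔ Sat r P v V φ := by
  have h1 : ∀ m (v : ℕ → A) (V : ℕ → Set A),
      Sat r P v V (closeFO k m φ) ↔ Sat r P v V φ := by
    intro m
    induction m with
    | zero => intros; rfl
    | succ m ih =>
      intro v V
      simp only [closeFO, Sat, ih]
      have : ∀ a, Sat r P (Function.update v (m + k) a) V φ ↔ Sat r P v V φ := fun a =>
        h _ _ _ _ fun i hi => by rw [Function.update_of_ne (by omega)]
      simp [this]
  have h2 : ∀ m p (v : ℕ → A) (V : ℕ → Set A),
      Sat r P v V (closeSO m (closeFO k p φ)) ↔ Sat r P v V φ := by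
    intro m p
    induction m with
    | zero => exact h1 p
    | succ m ih =>
      intro v V
      simp only [closeSO, Sat, ih]
      have : ∀ S, Sat r P v (Function.update V m S) φ ↔ Sat r P v V φ := fun a =>
        h _ _ _ _ fun i hi => rfl
      simp [this]
  exact h2 _ _ v V

/-! ### Replacing the last predicate by a set variable -/

/-- The translation reading the last predicate as the second-order variable `0`; the other
second-order variables are shifted by one. -/
def tr : MSO (n + 1) → MSO n
  | .lt i j => .lt i j
  | .pred k i => if h : (k : ℕ) < n then .pred ⟨k, h⟩ i else .mem i 0
  | .mem i j => .mem i (j + 1)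
  | .not φ => .not (tr φ)
  | .and φ ψ => .and (tr φ) (tr ψ)
  | .ex1 i φ => .ex1 i (tr φ)
  | .ex2 j φ => .ex2 (j + 1) (tr φ)

/-- The inclusion of formulas induced by adding a predicate to the signature. -/
def lift : MSO n → MSO (n + 1)
  | .lt i j => .lt i j
  | .pred k i => .pred k.castSucc i
  | .mem i j => .mem i j
  | .not φ => .not (lift φ)
  | .and φ ψ => .and (lift φ) (lift ψ)
  | .ex1 i φ => .ex1 i (lift φ)
  | .ex2 j φ => .ex2 j (lift φ)

theorem sat_tr {A : Type} (r : A → A → Prop) (P : Fin n → Set A) (φ : MSO (n + 1)) :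
    ∀ (v : ℕ → A) (V : ℕ → Set A), Sat r P v V (tr φ) ↔
      Sat r (Fin.snoc P (V 0) : Fin (n + 1) → Set A) v (fun j => V (j + 1)) φ := by
  induction φ with
  | lt i j => intros; rfl
  | pred k i =>
    intro v V
    by_cases h : (k : ℕ) < n
    · have e : (Fin.snoc P (V 0) : Fin (n + 1) → Set A) k = P ⟨k, h⟩ :=
        Fin.snoc_castSucc (α := fun _ => Set A) (V 0) P ⟨k, h⟩
      simp [tr, Sat, h, e]
    · have hk : k = Fin.last n := Fin.ext (by have := k.2; simp only [Fin.val_last]; omega)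
      subst hk
      simp [tr, Sat]
  | mem i j => intros; rfl
  | not φ ih => exact fun v V => not_congr (ih v V)
  | and φ ψ ih1 ih2 => exact fun v V => and_congr (ih1 v V) (ih2 v V)
  | ex1 i φ ih => exact fun v V => exists_congr fun a => ih _ _
  | ex2 j φ ih =>
    intro v V
    refine exists_congr fun S => (ih _ _).trans ?_
    rw [Function.update_of_ne (by omega)]
    have : (fun k => Function.update V (j + 1) S (k + 1)) =
        Function.update (fun k => V (k + 1)) j S := by
      ext1 k; simp [Function.update_apply]
    rw [this]

@[simp] theorem fv1_tr (φ : MSO (n + 1)) : fv1 (tr φ) = fv1 φ := by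
  induction φ with
  | pred k i => simp only [tr]; split_ifs <;> rfl
  | lt i j => rfl
  | mem i j => rfl
  | _ => simp_all [tr, fv1]

theorem succ_mem_fv2_tr (φ : MSO (n + 1)) (j : ℕ) : j + 1 ∈ fv2 (tr φ) ↔ j ∈ fv2 φ := by
  induction φ with
  | pred k i => simp only [tr]; split_ifs <;> simp [fv2]
  | _ => simp_all [tr, fv2]

theorem fv2_tr_subset {φ : MSO (n + 1)} (h : fv2 φ = ∅) : fv2 (tr φ) ⊆ {0} := by
  intro j hj
  cases j with
  | zero => simp
  | succ j => rw [succ_mem_fv2_tr, h] at hj; simp at hj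

theorem sat_lift {A : Type} (r : A → A → Prop) (P : Fin n → Set A) (X : Set A) (φ : MSO n) :
    ∀ (v : ℕ → A) (V : ℕ → Set A),
      Sat r (Fin.snoc P X : Fin (n + 1) → Set A) v V (lift φ) ↔ Sat r P v V φ := by
  induction φ with
  | pred k i => intro v V; simp [lift, Sat]
  | lt i j => intros; rfl
  | mem i j => intros; rfl
  | not φ ih => exact fun v V => not_congr (ih v V)
  | and φ ψ ih1 ih2 => exact fun v V => and_congr (ih1 v V) (ih2 v V)
  | ex1 i φ ih => exact fun v V => exists_congr fun a => ih _ _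
  | ex2 j φ ih => exact fun v V => exists_congr fun a => ih _ _

end MSO
end Paper

namespace Paper

/-! ### Finite types of labelled orders -/

/-- The finite set of possible `k`-types, for `p` predicates and `m` set parameters. -/
def Ty (p m : ℕ) : ℕ → Type
  | 0 => (Fin m → Fin m → Prop) × (Fin m → Fin m → Prop) × (Fin m → Prop) × (Fin m → Fin p → Prop)
  | k + 1 => Ty p m k × (Fin m → Set (Ty p m k))

instance Ty.finite (p m k : ℕ) : Finite (Ty p m k) := by
  induction k with
  | zero => unfold Ty; infer_instance
  | succ k ih => unfold Ty; infer_instance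

/-- The `k`-type of the labelled order induced on `D`, with set parameters `W`. -/
def tp {p : ℕ} (P : Fin p → Set ℤ) (m : ℕ) (D : Set ℤ) : (k : ℕ) → (ℕ → Set ℤ) → Ty p m k
  | 0, W => (fun i j => ∀ x ∈ D, x ∈ W i → x ∈ W j,
      fun i j => ∃ x ∈ D, ∃ y ∈ D, x < y ∧ x ∈ W i ∧ y ∈ W j,
      fun i => ∃ x ∈ D, x ∈ W i,
      fun i q => ∀ x ∈ D, x ∈ W i → x ∈ P q)
  | k + 1, W => (tp P m D k W, fun i => {t | ∃ S, tp P m D k (Function.update W i S) = t})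

section tp

variable {p m : ℕ} {P P' : Fin p → Set ℤ}

theorem tp_zero_eq_iff {D D' : Set ℤ} {W W' : ℕ → Set ℤ} :
    tp P m D 0 W = tp P' m D' 0 W' ↔
      (∀ i < m, ∀ j < m, (∀ x ∈ D, x ∈ W i → x ∈ W j) ↔ (∀ x ∈ D', x ∈ W' i → x ∈ W' j)) ∧
      (∀ i < m, ∀ j < m, (∃ x ∈ D, ∃ y ∈ D, x < y ∧ x ∈ W i ∧ y ∈ W j) ↔
        (∃ x ∈ D', ∃ y ∈ D', x < y ∧ x ∈ W' i ∧ y ∈ W' j)) ∧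
      (∀ i < m, (∃ x ∈ D, x ∈ W i) ↔ (∃ x ∈ D', x ∈ W' i)) ∧
      (∀ i < m, ∀ q : Fin p, (∀ x ∈ D, x ∈ W i → x ∈ P q) ↔ (∀ x ∈ D', x ∈ W' i → x ∈ P' q)) := by
  unfold tp
  erw [Prod.mk.injEq, Prod.mk.injEq, Prod.mk.injEq]
  simp only [funext_iff, eq_iff_iff, Fin.forall_iff]

theorem tp_succ_eq_iff {D D' : Set ℤ} {W W' : ℕ → Set ℤ} {k : ℕ} :
    tp P m D (k + 1) W = tp P' m D' (k + 1) W' ↔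
      tp P m D k W = tp P' m D' k W' ∧ ∀ i < m,
        (∀ S, ∃ S', tp P m D k (Function.update W i S) = tp P' m D' k (Function.update W' i S')) ∧
        (∀ S', ∃ S, tp P m D k (Function.update W i S) =
          tp P' m D' k (Function.update W' i S')) := by
  conv_lhs => unfold tp
  erw [Prod.mk.injEq]
  simp only [funext_iff, Fin.forall_iff, Set.ext_iff, Set.mem_ofPred_eq]
  refine and_congr_right fun _ => forall_congr' fun i => forall_congr' fun hi => ?_
  constructor
  · intro h
    refine ⟨fun S => ?_, fun S' => ?_⟩
    · obtain ⟨S', e⟩ := (h _).1 ⟨S, rfl⟩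
      exact ⟨S', e.symm⟩
    · exact (h _).2 ⟨S', rfl⟩
  · rintro ⟨h1, h2⟩ t
    constructor
    · rintro ⟨S, rfl⟩
      obtain ⟨S', e⟩ := h1 S
      exact ⟨S', e.symm⟩
    · rintro ⟨S', rfl⟩
      exact h2 S'

theorem tp_congr {D : Set ℤ} (k : ℕ) : ∀ {W W' : ℕ → Set ℤ},
    (∀ x ∈ D, ∀ q, x ∈ P q ↔ x ∈ P' q) → (∀ i, ∀ x ∈ D, x ∈ W i ↔ x ∈ W' i) →
      tp P m D k W = tp P' m D k W' := by
  induction k with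
  | zero =>
    intro W W' hP hW
    rw [tp_zero_eq_iff]
    refine ⟨fun i _ j _ => ?_, fun i _ j _ => ?_, fun i _ => ?_, fun i _ q => ?_⟩
    · exact forall₂_congr fun x hx => by rw [hW i x hx, hW j x hx]
    · refine exists_congr fun x => and_congr_right fun hx => exists_congr fun y =>
        and_congr_right fun hy => ?_
      rw [hW i x hx, hW j y hy]
    · exact exists_congr fun x => and_congr_right fun hx => hW i x hx
    · exact forall₂_congr fun x hx => by rw [hW i x hx, hP x hx q]
  | succ k ih =>
    intro W W' hP hW
    have h : ∀ i S, tp P m D k (Function.update W i S) =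
        tp P' m D k (Function.update W' i S) := by
      refine fun i S => ih hP fun j x hx => ?_
      by_cases e : j = i
      · subst e; simp
      · simp [e, hW j x hx]
    exact tp_succ_eq_iff.2 ⟨ih hP hW, fun i _ => ⟨fun S => ⟨S, h i S⟩, fun S => ⟨S, h i S⟩⟩⟩

/-- Types of ordered sums are determined by the types of the summands. -/
theorem tp_sum {J : Type} [LinearOrder J] {D D' : J → Set ℤ}
    (hD : ∀ i j, i < j → ∀ x ∈ D i, ∀ y ∈ D j, x < y)
    (hD' : ∀ i j, i < j → ∀ x ∈ D' i, ∀ y ∈ D' j, x < y) (k : ℕ) :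
    ∀ {W W' : ℕ → Set ℤ}, (∀ j, tp P m (D j) k W = tp P' m (D' j) k W') →
      tp P m (⋃ j, D j) k W = tp P' m (⋃ j, D' j) k W' := by
  induction k with
  | zero =>
    intro W W' h
    simp only [tp_zero_eq_iff] at h
    have lt_iff : ∀ {P : Fin p → Set ℤ} {D : J → Set ℤ} {W : ℕ → Set ℤ},
        (∀ i j, i < j → ∀ x ∈ D i, ∀ y ∈ D j, x < y) → ∀ a b,
        ((∃ x ∈ ⋃ j, D j, ∃ y ∈ ⋃ j, D j, x < y ∧ x ∈ W a ∧ y ∈ W b) ↔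
          (∃ j, ∃ x ∈ D j, ∃ y ∈ D j, x < y ∧ x ∈ W a ∧ y ∈ W b) ∨
          ∃ i j, i < j ∧ (∃ x ∈ D i, x ∈ W a) ∧ ∃ y ∈ D j, y ∈ W b) := by
      intro P D W hD a b
      constructor
      · rintro ⟨x, hx, y, hy, hxy, hxa, hyb⟩
        obtain ⟨i, hi⟩ := Set.mem_iUnion.1 hx
        obtain ⟨j, hj⟩ := Set.mem_iUnion.1 hy
        rcases lt_trichotomy i j with e | e | e
        · exact Or.inr ⟨i, j, e, ⟨x, hi, hxa⟩, y, hj, hyb⟩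
        · subst e
          exact Or.inl ⟨i, x, hi, y, hj, hxy, hxa, hyb⟩
        · exact absurd (hD j i e y hj x hi) hxy.not_gt
      · rintro (⟨j, x, hx, y, hy, r⟩ | ⟨i, j, hij, ⟨x, hx, hxa⟩, y, hy, hyb⟩)
        · exact ⟨x, Set.mem_iUnion.2 ⟨j, hx⟩, y, Set.mem_iUnion.2 ⟨j, hy⟩, r⟩
        · exact ⟨x, Set.mem_iUnion.2 ⟨i, hx⟩, y, Set.mem_iUnion.2 ⟨j, hy⟩,
            hD i j hij x hx y hy, hxa, hyb⟩
    rw [tp_zero_eq_iff]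
    refine ⟨fun a ha b hb => ?_, fun a ha b hb => ?_, fun a ha => ?_, fun a ha q => ?_⟩
    · have := fun j => (h j).1 a ha b hb
      simp only [Set.mem_iUnion, forall_exists_index]
      rw [forall_comm, forall_congr' this, forall_comm]
    · rw [lt_iff (P := P) hD, lt_iff (P := P') hD']
      refine or_congr (exists_congr fun j => (h j).2.1 a ha b hb) ?_
      exact exists_congr fun i => exists_congr fun j => and_congr_right fun _ =>
        and_congr ((h i).2.2.1 a ha) ((h j).2.2.1 b hb)
    · have := fun j => (h j).2.2.1 a ha
      simp only [Set.mem_iUnion]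
      constructor
      · rintro ⟨x, ⟨j, hj⟩, hx⟩
        obtain ⟨y, hy, hya⟩ := (this j).1 ⟨x, hj, hx⟩
        exact ⟨y, ⟨j, hy⟩, hya⟩
      · rintro ⟨x, ⟨j, hj⟩, hx⟩
        obtain ⟨y, hy, hya⟩ := (this j).2 ⟨x, hj, hx⟩
        exact ⟨y, ⟨j, hy⟩, hya⟩
    · have := fun j => (h j).2.2.2 a ha q
      simp only [Set.mem_iUnion, forall_exists_index]
      rw [forall_comm, forall_congr' this, forall_comm]
  | succ k ih =>
    intro W W' h
    simp only [tp_succ_eq_iff] at h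
    have glue : ∀ {P : Fin p → Set ℤ} {D : J → Set ℤ} {W : ℕ → Set ℤ},
        (∀ i j, i < j → ∀ x ∈ D i, ∀ y ∈ D j, x < y) → ∀ (a : ℕ) (T : J → Set ℤ),
        ∃ S, ∀ j, tp P m (D j) k (Function.update W a (T j)) =
          tp P m (D j) k (Function.update W a S) := by
      intro P D W hD a T
      refine ⟨⋃ j, D j ∩ T j, fun j => tp_congr k (fun _ _ _ => Iff.rfl) fun b x hx => ?_⟩
      by_cases e : b = a
      · subst e
        simp only [Function.update_self, Set.mem_iUnion, Set.mem_inter_iff]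
        constructor
        · exact fun hT => ⟨j, hx, hT⟩
        · rintro ⟨i, hi, hT⟩
          rcases lt_trichotomy i j with e | e | e
          · exact absurd (hD i j e x hi x hx) (lt_irrefl _)
          · rwa [← e]
          · exact absurd (hD j i e x hx x hi) (lt_irrefl _)
      · simp [e]
    refine tp_succ_eq_iff.2 ⟨ih fun j => (h j).1, fun a ha => ⟨fun S => ?_, fun S => ?_⟩⟩
    · choose T hT using fun j => ((h j).2 a ha).1 S
      obtain ⟨S', hS'⟩ := glue (P := P') (W := W') hD' a T
      exact ⟨S', ih fun j => (hT j).trans (hS' j)⟩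
    · choose T hT using fun j => ((h j).2 a ha).2 S
      obtain ⟨S', hS'⟩ := glue (P := P) (W := W) hD a T
      exact ⟨S', ih fun j => (hS' j).symm.trans (hT j)⟩

theorem tp_zero_of_tp {D D' : Set ℤ} {W W' : ℕ → Set ℤ} {k : ℕ}
    (h : tp P m D k W = tp P' m D' k W') : tp P m D 0 W = tp P' m D' 0 W' := by
  induction k with
  | zero => exact h
  | succ k ih => exact ih (tp_succ_eq_iff.1 h).1

end tp

open MSO in
/-- Types determine the truth of formulas. -/
theorem sat_iff_of_tp_eq {p m : ℕ} (φ : MSO p) :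
    ∀ {P P' : Fin p → Set ℤ} {k : ℕ} {v v' : ℕ → ℤ} {V V' W W' : ℕ → Set ℤ}, qd φ ≤ k →
      2 * encode φ + 1 < m →
      (∀ i ∈ fv1 φ, W (2 * i) = {v i} ∧ W' (2 * i) = {v' i}) →
      (∀ j ∈ fv2 φ, W (2 * j + 1) = V j ∧ W' (2 * j + 1) = V' j) →
      tp P m Set.univ k W = tp P' m Set.univ k W' →
      (ZSat P v V φ ↔ ZSat P' v' V' φ) := by
  induction φ with
  | lt i j =>
    intro P P' k v v' V V' W W' _ hm h1 _ h
    have h := (tp_zero_eq_iff.1 (tp_zero_of_tp h)).2.1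
    have hi := le_encode_of_mem_fv1 (.lt i j : MSO p) i (by simp [fv1])
    have hj := le_encode_of_mem_fv1 (.lt i j : MSO p) j (by simp [fv1])
    have := h (2 * i) (by omega) (2 * j) (by omega)
    rw [(h1 i (by simp [fv1])).1, (h1 j (by simp [fv1])).1, (h1 i (by simp [fv1])).2,
      (h1 j (by simp [fv1])).2] at this
    simpa [Sat] using this
  | pred q i =>
    intro P P' k v v' V V' W W' _ hm h1 _ h
    have h := (tp_zero_eq_iff.1 (tp_zero_of_tp h)).2.2.2
    have hi := le_encode_of_mem_fv1 (.pred q i : MSO p) i (by simp [fv1])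
    have := h (2 * i) (by omega) q
    rw [(h1 i (by simp [fv1])).1, (h1 i (by simp [fv1])).2] at this
    simpa [Sat] using this
  | mem i j =>
    intro P P' k v v' V V' W W' _ hm h1 h2 h
    have h := (tp_zero_eq_iff.1 (tp_zero_of_tp h)).1
    have hi := le_encode_of_mem_fv1 (.mem i j : MSO p) i (by simp [fv1])
    have hj := le_encode_of_mem_fv2 (.mem i j : MSO p) j (by simp [fv2])
    have := h (2 * i) (by omega) (2 * j + 1) (by omega)
    rw [(h1 i (by simp [fv1])).1, (h1 i (by simp [fv1])).2, (h2 j (by simp [fv2])).1,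
      (h2 j (by simp [fv2])).2] at this
    simpa [Sat] using this
  | not φ ih =>
    intro P P' k v v' V V' W W' hk hm h1 h2 h
    have := Nat.right_le_pair 3 (encode φ)
    exact not_congr (ih hk (by simp only [encode] at hm; omega) h1 h2 h)
  | and φ ψ ih1 ih2 =>
    intro P P' k v v' V V' W W' hk hm h1 h2 h
    have := Nat.right_le_pair 4 (Nat.pair (encode φ) (encode ψ))
    have := Nat.left_le_pair (encode φ) (encode ψ)
    have := Nat.right_le_pair (encode φ) (encode ψ)
    simp only [encode] at hm
    simp only [qd, max_le_iff] at hk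
    exact and_congr
      (ih1 hk.1 (by omega) (fun i hi => h1 i (by simp [fv1, hi]))
        (fun i hi => h2 i (by simp [fv2, hi])) h)
      (ih2 hk.2 (by omega) (fun i hi => h1 i (by simp [fv1, hi]))
        (fun i hi => h2 i (by simp [fv2, hi])) h)
  | ex1 i φ ih =>
    have fwd : ∀ {P P' : Fin p → Set ℤ} {k : ℕ} {v v' : ℕ → ℤ} {V V' W W' : ℕ → Set ℤ},
        qd (.ex1 i φ) ≤ k → 2 * encode (.ex1 i φ) + 1 < m →
        (∀ j ∈ fv1 (.ex1 i φ), W (2 * j) = {v j} ∧ W' (2 * j) = {v' j}) →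
        (∀ j ∈ fv2 (.ex1 i φ), W (2 * j + 1) = V j ∧ W' (2 * j + 1) = V' j) →
        tp P m Set.univ k W = tp P' m Set.univ k W' →
        ZSat P v V (.ex1 i φ) → ZSat P' v' V' (.ex1 i φ) := by
      rintro P P' k v v' V V' W W' hk hm h1 h2 h ⟨a, ha⟩
      have := Nat.right_le_pair 5 (Nat.pair i (encode φ))
      have := Nat.left_le_pair i (encode φ)
      have := Nat.right_le_pair i (encode φ)
      simp only [encode] at hm
      obtain ⟨k, rfl⟩ : ∃ l, k = l + 1 := ⟨k - 1, by simp only [qd] at hk; omega⟩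
      obtain ⟨S, hS⟩ := ((tp_succ_eq_iff.1 h).2 (2 * i) (by omega)).1 {a}
      obtain ⟨b, rfl⟩ : ∃ b, S = {b} := by
        have h0 := tp_zero_eq_iff.1 (tp_zero_of_tp hS)
        obtain ⟨b, _, hb⟩ := (h0.2.2.1 (2 * i) (by omega)).1 (by simp)
        have hlt := h0.2.1 (2 * i) (by omega) (2 * i) (by omega)
        simp only [Function.update_self, Set.mem_univ, true_and, Set.mem_singleton_iff] at hlt hb
        refine ⟨b, Set.eq_singleton_iff_unique_mem.2 ⟨hb, fun c hc => ?_⟩⟩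
        by_contra hne
        have : ∃ x y, x < y ∧ x ∈ S ∧ y ∈ S := by
          rcases lt_or_gt_of_ne hne with e | e
          · exact ⟨c, b, e, hc, hb⟩
          · exact ⟨b, c, e, hb, hc⟩
        obtain ⟨x, y, hxy, hx, hy⟩ := hlt.2 this
        omega
      refine ⟨b, (ih (by simpa [qd] using hk) (by omega) (fun j hj => ?_) (fun j hj => ?_) hS).1 ha⟩
      · by_cases e : j = i
        · subst e; simp
        · have e2 : 2 * j ≠ 2 * i := by omega
          simp only [Function.update_of_ne e, Function.update_of_ne e2]
          exact h1 j (by simp [fv1, hj, e])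
      · have e2 : 2 * j + 1 ≠ 2 * i := by omega
        simp only [Function.update_of_ne e2]
        exact h2 j (by simpa [fv2] using hj)
    intro P P' k v v' V V' W W' hk hm h1 h2 h
    exact ⟨fwd hk hm h1 h2 h,
      fwd hk hm (fun j hj => (h1 j hj).symm) (fun j hj => (h2 j hj).symm) h.symm⟩
  | ex2 i φ ih =>
    have fwd : ∀ {P P' : Fin p → Set ℤ} {k : ℕ} {v v' : ℕ → ℤ} {V V' W W' : ℕ → Set ℤ},
        qd (.ex2 i φ) ≤ k → 2 * encode (.ex2 i φ) + 1 < m →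
        (∀ j ∈ fv1 (.ex2 i φ), W (2 * j) = {v j} ∧ W' (2 * j) = {v' j}) →
        (∀ j ∈ fv2 (.ex2 i φ), W (2 * j + 1) = V j ∧ W' (2 * j + 1) = V' j) →
        tp P m Set.univ k W = tp P' m Set.univ k W' →
        ZSat P v V (.ex2 i φ) → ZSat P' v' V' (.ex2 i φ) := by
      rintro P P' k v v' V V' W W' hk hm h1 h2 h ⟨a, ha⟩
      have := Nat.right_le_pair 6 (Nat.pair i (encode φ))
      have := Nat.left_le_pair i (encode φ)
      have := Nat.right_le_pair i (encode φ)
      simp only [encode] at hm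
      obtain ⟨k, rfl⟩ : ∃ l, k = l + 1 := ⟨k - 1, by simp only [qd] at hk; omega⟩
      obtain ⟨S, hS⟩ := ((tp_succ_eq_iff.1 h).2 (2 * i + 1) (by omega)).1 a
      refine ⟨S, (ih (by simpa [qd] using hk) (by omega) (fun j hj => ?_) (fun j hj => ?_) hS).1 ha⟩
      · have e2 : 2 * j ≠ 2 * i + 1 := by omega
        simp only [Function.update_of_ne e2]
        exact h1 j (by simpa [fv1] using hj)
      · by_cases e : j = i
        · subst e; simp
        · have e2 : 2 * j + 1 ≠ 2 * i + 1 := by omega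
          simp only [Function.update_of_ne e, Function.update_of_ne e2]
          exact h2 j (by simp [fv2, hj, e])
    intro P P' k v v' V V' W W' hk hm h1 h2 h
    exact ⟨fwd hk hm h1 h2 h,
      fwd hk hm (fun j hj => (h1 j hj).symm) (fun j hj => (h2 j hj).symm) h.symm⟩

end Paper

namespace Paper

/-! ### Additive colourings and the type of the whole line -/

/-- The colour `e` recurs beyond `N` from the base point `i`. -/
def Recurs {T : Type} (χ : ℤ → ℤ → T) (i : ℤ) (e : T) (N : ℤ) : Prop :=
  ∃ j, N ≤ j ∧ i < j ∧ χ i j = e ∧ ∃ c, j ≤ c ∧ χ i c = χ j c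

theorem exists_eventually_eq_of_finite {α T : Type} [Finite T] (U : Ultrafilter α) (f : α → T) :
    ∃ t, ∀ᶠ x in (U : Filter α), f x = t := by
  obtain ⟨t, ht⟩ := (U.map f).eq_pure_of_finite
  refine ⟨t, ?_⟩
  have : {t} ∈ U.map f := by rw [ht]; exact Ultrafilter.mem_pure.2 rfl
  exact this

theorem exists_recurs {T : Type} [Finite T] (χ : ℤ → ℤ → T) :
    ∃ i, 0 ≤ i ∧ ∃ b, i < b ∧ ∀ N, Recurs χ i (χ i b) N := by
  let U : Ultrafilter ℤ := Ultrafilter.of Filter.atTop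
  have hU : ∀ N, ∀ᶠ x in (U : Filter ℤ), N ≤ x := fun N =>
    Ultrafilter.of_le Filter.atTop (Filter.eventually_ge_atTop N)
  choose t ht using fun x => exists_eventually_eq_of_finite U (χ x)
  obtain ⟨t₀, ht₀⟩ := exists_eventually_eq_of_finite U t
  obtain ⟨i, hi0, hi⟩ := ((hU 0).and ht₀).exists
  obtain ⟨b, hb, hib⟩ := ((hU (i + 1)).and (ht i)).exists
  refine ⟨i, hi0, b, by omega, fun N => ?_⟩
  obtain ⟨j, ⟨⟨hjN, hji⟩, hjt⟩, hj⟩ := ((((hU N).and (hU (i + 1))).and (ht i)).and ht₀).exists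
  obtain ⟨c, ⟨hc, hci⟩, hcj⟩ := (((hU j).and (ht i)).and (ht j)).exists
  exact ⟨j, hjN, by omega, by rw [hjt, hib], c, hc, by rw [hci, hcj, hi, hj]⟩

theorem exists_seq_of_recurs {T : Type} {χ : ℤ → ℤ → T} {i : ℤ} {e : T}
    (hχ : ∀ x y c c', x ≤ c → y ≤ c → c ≤ c' → χ x c = χ y c → χ x c' = χ y c')
    (h : ∀ N, Recurs χ i e N) :
    ∃ s : ℕ → ℤ, s 0 = i ∧ StrictMono s ∧ ∀ m, χ (s m) (s (m + 1)) = e := by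
  have step : ∀ q : {q : ℤ × ℤ // i ≤ q.1 ∧ q.1 ≤ q.2 ∧ χ i q.2 = χ q.1 q.2},
      ∃ q' : {q : ℤ × ℤ // i ≤ q.1 ∧ q.1 ≤ q.2 ∧ χ i q.2 = χ q.1 q.2},
        q.1.1 < q'.1.1 ∧ χ q.1.1 q'.1.1 = e := by
    rintro ⟨⟨j, c⟩, hij, hjc, hc⟩
    obtain ⟨j', hj', hij', he, c', hc', hcc⟩ := h (max c (j + 1))
    refine ⟨⟨(j', c'), hij'.le, hc', hcc⟩, by simp only at *; omega, ?_⟩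
    simp only at *
    rw [← hχ i j c j' (by omega) (by omega) (by omega) hc, he]
  choose f hf using step
  let q : ℕ → {q : ℤ × ℤ // i ≤ q.1 ∧ q.1 ≤ q.2 ∧ χ i q.2 = χ q.1 q.2} :=
    fun m => f^[m] ⟨(i, i), le_rfl, le_rfl, rfl⟩
  have hq : ∀ m, q (m + 1) = f (q m) := fun m => Function.iterate_succ_apply' f m _
  refine ⟨fun m => (q m).1.1, rfl, strictMono_nat_of_lt_succ fun m => ?_, fun m => ?_⟩
  · simp only [hq]; exact (hf _).1
  · simp only [hq]; exact (hf _).2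

theorem add_le_of_strictMono {s : ℕ → ℤ} (hs : StrictMono s) (m : ℕ) : s 0 + m ≤ s m := by
  induction m with
  | zero => simp
  | succ m ih =>
    have := hs (Nat.lt_succ_self m)
    push_cast
    simp only [Nat.succ_eq_add_one] at this
    omega

theorem iUnion_Ico_of_strictMono {s : ℕ → ℤ} (hs : StrictMono s) :
    ⋃ m, Set.Ico (s m) (s (m + 1)) = Set.Ici (s 0) := by
  ext x
  simp only [Set.mem_iUnion, Set.mem_Ico, Set.mem_Ici]
  constructor
  · rintro ⟨m, hm, _⟩
    exact (hs.monotone (Nat.zero_le m)).trans hm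
  · intro hx
    classical
    have hex : ∃ m, x < s m := by
      refine ⟨(x - s 0).toNat + 1, ?_⟩
      have := add_le_of_strictMono hs ((x - s 0).toNat + 1)
      push_cast at this
      omega
    obtain ⟨m, hm⟩ : ∃ m, Nat.find hex = m + 1 := by
      refine ⟨Nat.find hex - 1, ?_⟩
      have : Nat.find hex ≠ 0 := fun h0 => by
        have := Nat.find_spec hex
        rw [h0] at this
        omega
      omega
    refine ⟨m, ?_, ?_⟩
    · have := Nat.find_min hex (m := m) (by omega)
      omega
    · rw [← hm]; exact Nat.find_spec hex

theorem iUnion_Ico_neg_of_strictMono {s : ℕ → ℤ} (hs : StrictMono s) :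
    ⋃ m, Set.Ico (-s (m + 1)) (-s m) = Set.Iio (-s 0) := by
  have hs' : StrictMono fun m => s m + 1 := fun a b h => by have := hs h; simp only; omega
  ext x
  have := Set.ext_iff.1 (iUnion_Ico_of_strictMono hs') (-x + 0)
  simp only [Set.mem_iUnion, Set.mem_Ico, Set.mem_Ici, Set.mem_Iio] at this ⊢
  constructor
  · rintro ⟨m, h1, h2⟩
    have := this.1 ⟨m, by omega, by omega⟩
    omega
  · intro h
    obtain ⟨m, h1, h2⟩ := this.2 (by omega)
    exact ⟨m, by omega, by omega⟩

/-- The `k`-type of the segment `[x, y)`. -/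
def segTp {p : ℕ} (P : Fin p → Set ℤ) (m k : ℕ) (x y : ℤ) : Ty p m k :=
  tp P m (Set.Ico x y) k fun _ => ∅

section segTp

variable {p m k : ℕ} {P P' : Fin p → Set ℤ}

theorem segTp_append {x y z x' y' z' : ℤ} (hxy : x ≤ y) (hyz : y ≤ z) (hxy' : x' ≤ y')
    (hyz' : y' ≤ z') (h1 : segTp P m k x y = segTp P' m k x' y')
    (h2 : segTp P m k y z = segTp P' m k y' z') : segTp P m k x z = segTp P' m k x' z' := by
  have union : ∀ {x y z : ℤ}, x ≤ y → y ≤ z →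
      Set.Ico x z = ⋃ b : Bool, cond b (Set.Ico y z) (Set.Ico x y) := by
    intro x y z h1 h2
    ext t
    simp only [Set.mem_iUnion, Bool.exists_bool, cond_true, cond_false, Set.mem_Ico]
    omega
  have ord : ∀ {x y z : ℤ}, ∀ i j : Bool, i < j → ∀ s ∈ cond i (Set.Ico y z) (Set.Ico x y),
      ∀ t ∈ cond j (Set.Ico y z) (Set.Ico x y), s < t := by
    intro x y z i j hij s hs t ht
    obtain ⟨rfl, rfl⟩ := Bool.lt_iff.1 hij
    simp only [cond_true, cond_false, Set.mem_Ico] at hs ht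
    omega
  rw [segTp, segTp, union hxy hyz, union hxy' hyz']
  refine tp_sum ord ord k fun j => ?_
  cases j
  · exact h1
  · exact h2

theorem tp_Ici_eq {i : ℤ} {e : Ty p m k} (h : ∀ N, Recurs (segTp P m k) i e N)
    (h' : ∀ N, Recurs (segTp P' m k) i e N) :
    tp P m (Set.Ici i) k (fun _ => ∅) = tp P' m (Set.Ici i) k (fun _ => ∅) := by
  have congr : ∀ (P : Fin p → Set ℤ) (x y c c' : ℤ), x ≤ c → y ≤ c → c ≤ c' →
      segTp P m k x c = segTp P m k y c → segTp P m k x c' = segTp P m k y c' :=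
    fun P x y c c' h1 h2 h3 h4 => segTp_append h1 h3 h2 h3 h4 rfl
  obtain ⟨s, hs0, hs, hse⟩ := exists_seq_of_recurs (congr P) h
  obtain ⟨s', hs0', hs', hse'⟩ := exists_seq_of_recurs (congr P') h'
  have ord : ∀ {s : ℕ → ℤ}, StrictMono s → ∀ i j, i < j → ∀ x ∈ Set.Ico (s i) (s (i + 1)),
      ∀ y ∈ Set.Ico (s j) (s (j + 1)), x < y := by
    intro s hs i j hij x hx y hy
    have := hs.monotone (Nat.succ_le_of_lt hij)
    simp only [Set.mem_Ico, Nat.succ_eq_add_one] at *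
    omega
  conv_lhs => rw [← hs0, ← iUnion_Ico_of_strictMono hs]
  conv_rhs => rw [← hs0', ← iUnion_Ico_of_strictMono hs']
  exact tp_sum (ord hs) (ord hs') k fun j => (hse j).trans (hse' j).symm

theorem tp_Iio_eq {i : ℤ} {e : Ty p m k}
    (h : ∀ N, Recurs (fun x y => segTp P m k (-y) (-x)) i e N)
    (h' : ∀ N, Recurs (fun x y => segTp P' m k (-y) (-x)) i e N) :
    tp P m (Set.Iio (-i)) k (fun _ => ∅) = tp P' m (Set.Iio (-i)) k (fun _ => ∅) := by
  have congr : ∀ (P : Fin p → Set ℤ) (x y c c' : ℤ), x ≤ c → y ≤ c → c ≤ c' →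
      segTp P m k (-c) (-x) = segTp P m k (-c) (-y) →
      segTp P m k (-c') (-x) = segTp P m k (-c') (-y) :=
    fun P x y c c' h1 h2 h3 h4 => segTp_append (by omega) (by omega) (by omega) (by omega) rfl h4
  obtain ⟨s, hs0, hs, hse⟩ := exists_seq_of_recurs (congr P) h
  obtain ⟨s', hs0', hs', hse'⟩ := exists_seq_of_recurs (congr P') h'
  have ord : ∀ {s : ℕ → ℤ}, StrictMono s → ∀ i j : ℕᵒᵈ, i < j →
      ∀ x ∈ Set.Ico (-s (i.ofDual + 1)) (-s i.ofDual),
      ∀ y ∈ Set.Ico (-s (j.ofDual + 1)) (-s j.ofDual), x < y := by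
    intro s hs i j hij x hx y hy
    have := hs.monotone (Nat.succ_le_of_lt (OrderDual.ofDual_lt_ofDual.2 hij))
    simp only [Set.mem_Ico, Nat.succ_eq_add_one] at *
    omega
  have union : ∀ {s : ℕ → ℤ}, StrictMono s →
      Set.Iio (-s 0) = ⋃ j : ℕᵒᵈ, Set.Ico (-s (j.ofDual + 1)) (-s j.ofDual) :=
    fun hs => (iUnion_Ico_neg_of_strictMono hs).symm
  conv_lhs => rw [← hs0, union hs]
  conv_rhs => rw [← hs0', union hs']
  exact tp_sum (ord hs) (ord hs') k fun j => (hse j.ofDual).trans (hse' j.ofDual).symm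

/-- The statement, local in the predicates, that the colours of `[d, b)` and `[a, c)` recur on
the right and on the left beyond `N`. -/
def SegRecurs (P : Fin p → Set ℤ) (m k : ℕ) (N a b c d : ℤ) : Prop :=
  (∃ j, N ≤ j ∧ d < j ∧ segTp P m k d j = segTp P m k d b ∧
    ∃ z, j ≤ z ∧ segTp P m k d z = segTp P m k j z) ∧
  (∃ j, j ≤ N ∧ j < c ∧ segTp P m k j c = segTp P m k a c ∧
    ∃ z, z ≤ j ∧ segTp P m k z c = segTp P m k z j)

theorem exists_segRecurs (P : Fin p → Set ℤ) (m k : ℕ) :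
    ∃ a b c d, a ≤ c ∧ c ≤ d ∧ d ≤ b ∧ ∀ N, SegRecurs P m k N a b c d := by
  obtain ⟨d, hd, b, hdb, hR⟩ := exists_recurs (segTp P m k)
  obtain ⟨c, hc, a, hac, hL⟩ := exists_recurs fun x y => segTp P m k (-y) (-x)
  refine ⟨-a, b, -c, d, by omega, by omega, by omega, fun N => ⟨hR N, ?_⟩⟩
  obtain ⟨j, h1, h2, h3, z, h4, h5⟩ := hL (-N)
  exact ⟨-j, by omega, by omega, h3, -z, by omega, h5⟩

theorem tp_univ_eq {a b c d : ℤ} (hcd : c ≤ d) (h : ∀ N, SegRecurs P m k N a b c d)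
    (h' : ∀ N, SegRecurs P' m k N a b c d) (hac : segTp P m k a c = segTp P' m k a c)
    (hcd' : segTp P m k c d = segTp P' m k c d) (hdb : segTp P m k d b = segTp P' m k d b) :
    tp P m Set.univ k (fun _ => ∅) = tp P' m Set.univ k (fun _ => ∅) := by
  have hR : tp P m (Set.Ici d) k (fun _ => ∅) = tp P' m (Set.Ici d) k (fun _ => ∅) :=
    tp_Ici_eq (fun N => (h N).1) (by rw [hdb]; exact fun N => (h' N).1)
  have left : ∀ {P : Fin p → Set ℤ}, (∀ N, SegRecurs P m k N a b c d) →
      ∀ N, Recurs (fun x y => segTp P m k (-y) (-x)) (-c) (segTp P m k a c) N := by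
    intro P h N
    obtain ⟨j, h1, h2, h3, z, h4, h5⟩ := (h (-N)).2
    exact ⟨-j, by omega, by omega, by simpa using h3, -z, by omega, by simpa using h5⟩
  have hL : tp P m (Set.Iio (- -c)) k (fun _ => ∅) = tp P' m (Set.Iio (- -c)) k (fun _ => ∅) :=
    tp_Iio_eq (left h) (by rw [hac]; exact left h')
  rw [neg_neg] at hL
  let D : Fin 3 → Set ℤ := ![Set.Iio c, Set.Ico c d, Set.Ici d]
  have hD : (Set.univ : Set ℤ) = ⋃ j, D j := by
    ext t
    simp only [Set.mem_univ, Set.mem_iUnion, true_iff]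
    rcases lt_or_ge t c with e | e
    · exact ⟨0, e⟩
    · rcases lt_or_ge t d with e' | e'
      · exact ⟨1, e, e'⟩
      · exact ⟨2, e'⟩
  have ord : ∀ i j, i < j → ∀ x ∈ D i, ∀ y ∈ D j, x < y := by
    intro i j hij x hx y hy
    fin_cases i <;> fin_cases j <;>
      simp [D] at hij hx hy <;> omega
  rw [hD]
  refine tp_sum ord ord k fun j => ?_
  fin_cases j
  · exact hL
  · exact hcd'
  · exact hR

end segTp

end Paper

namespace Paper

/-! ### Relations expressible by a formula, uniformly in the predicates -/

/-- A relation between predicates and assignments that is expressed by some formula. -/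
def Expressible {p : ℕ} (R : (Fin p → Set ℤ) → (ℕ → ℤ) → (ℕ → Set ℤ) → Prop) : Prop :=
  ∃ ψ : MSO p, ∀ P v V, ZSat P v V ψ ↔ R P v V

namespace Expressible

variable {p : ℕ} {R R' : (Fin p → Set ℤ) → (ℕ → ℤ) → (ℕ → Set ℤ) → Prop}

theorem of_iff (h : Expressible R) (e : ∀ P v V, R P v V ↔ R' P v V) : Expressible R' := by
  obtain ⟨ψ, hψ⟩ := h
  exact ⟨ψ, fun P v V => (hψ P v V).trans (e P v V)⟩

theorem lt (i j : ℕ) : Expressible (p := p) fun _ v _ => v i < v j :=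
  ⟨.lt i j, fun _ _ _ => Iff.rfl⟩

theorem le (i j : ℕ) : Expressible (p := p) fun _ v _ => v i ≤ v j :=
  ⟨.le i j, fun _ _ _ => MSO.sat_le _ _ _ _ _⟩

theorem mem (i j : ℕ) : Expressible (p := p) fun _ v V => v i ∈ V j :=
  ⟨.mem i j, fun _ _ _ => Iff.rfl⟩

theorem pred (k : Fin p) (i : ℕ) : Expressible (p := p) fun P v _ => v i ∈ P k :=
  ⟨.pred k i, fun _ _ _ => Iff.rfl⟩

theorem not (h : Expressible R) : Expressible fun P v V => ¬ R P v V := by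
  obtain ⟨ψ, hψ⟩ := h
  exact ⟨.not ψ, fun P v V => not_congr (hψ P v V)⟩

theorem and (h : Expressible R) (h' : Expressible R') :
    Expressible fun P v V => R P v V ∧ R' P v V := by
  obtain ⟨ψ, hψ⟩ := h
  obtain ⟨ψ', hψ'⟩ := h'
  exact ⟨.and ψ ψ', fun P v V => and_congr (hψ P v V) (hψ' P v V)⟩

theorem imp (h : Expressible R) (h' : Expressible R') :
    Expressible fun P v V => R P v V → R' P v V := by
  obtain ⟨ψ, hψ⟩ := h
  obtain ⟨ψ', hψ'⟩ := h'
  exact ⟨.imp ψ ψ', fun P v V => by rw [MSO.sat_imp, hψ, hψ']⟩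

theorem iff (h : Expressible R) (h' : Expressible R') :
    Expressible fun P v V => (R P v V ↔ R' P v V) := by
  obtain ⟨ψ, hψ⟩ := h
  obtain ⟨ψ', hψ'⟩ := h'
  exact ⟨.iff ψ ψ', fun P v V => by rw [MSO.sat_iff, hψ, hψ']⟩

theorem ex1 (i : ℕ) (h : Expressible R) :
    Expressible fun P v V => ∃ a, R P (Function.update v i a) V := by
  obtain ⟨ψ, hψ⟩ := h
  exact ⟨.ex1 i ψ, fun P v V => exists_congr fun a => hψ _ _ _⟩

theorem all1 (i : ℕ) (h : Expressible R) :
    Expressible fun P v V => ∀ a, R P (Function.update v i a) V := by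
  obtain ⟨ψ, hψ⟩ := h
  exact ⟨.all1 i ψ, fun P v V => by simp only [MSO.sat_all1, hψ]⟩

theorem ex2 (i : ℕ) (h : Expressible R) :
    Expressible fun P v V => ∃ S, R P v (Function.update V i S) := by
  obtain ⟨ψ, hψ⟩ := h
  exact ⟨.ex2 i ψ, fun P v V => exists_congr fun a => hψ _ _ _⟩

theorem all2 (i : ℕ) (h : Expressible R) :
    Expressible fun P v V => ∀ S, R P v (Function.update V i S) := by
  obtain ⟨ψ, hψ⟩ := h
  exact ⟨.all2 i ψ, fun P v V => by simp only [MSO.sat_all2, hψ]⟩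

theorem true : Expressible (p := p) fun _ _ _ => True :=
  (Expressible.imp (lt 0 0) (lt 0 0)).of_iff fun _ _ _ => by simp

theorem forall_lt {F : ℕ → (Fin p → Set ℤ) → (ℕ → ℤ) → (ℕ → Set ℤ) → Prop} (m : ℕ)
    (h : ∀ i, Expressible (F i)) : Expressible fun P v V => ∀ i < m, F i P v V := by
  induction m with
  | zero => exact true.of_iff fun _ _ _ => by simp
  | succ m ih => exact (ih.and (h m)).of_iff fun P v V => Nat.forall_lt_succ_right.symm

theorem forall_fin {q : ℕ} {F : Fin q → (Fin p → Set ℤ) → (ℕ → ℤ) → (ℕ → Set ℤ) → Prop}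
    (h : ∀ i, Expressible (F i)) : Expressible fun P v V => ∀ i, F i P v V := by
  have := forall_lt (F := fun i P v V => ∀ hi : i < q, F ⟨i, hi⟩ P v V) q fun i => by
    by_cases hi : i < q
    · exact (h ⟨i, hi⟩).of_iff fun P v V => by simp [hi]
    · exact true.of_iff fun P v V => by simp [hi]
  refine this.of_iff fun P v V => ?_
  rw [Fin.forall_iff]
  exact ⟨fun H i hi => H i hi hi, fun H i hi _ => H i hi⟩

theorem empty (h : Expressible R) : Expressible fun P v _ => R P v fun _ => ∅ := by
  have key : ∀ M, Expressible fun P v V => R P v fun j => if j < M then ∅ else V j := by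
    intro M
    induction M with
    | zero => exact h.of_iff fun _ _ _ => by simp
    | succ M ih =>
      refine (ex2 M ((all1 0 (mem 0 M).not).and ih)).of_iff fun P v V => ?_
      simp only [Function.update_self]
      constructor
      · rintro ⟨S, hS, hR⟩
        have : S = ∅ := Set.eq_empty_iff_forall_notMem.2 hS
        subst this
        convert hR using 2 with j
        rcases lt_trichotomy j M with e | e | e
        · simp [e, e.trans (Nat.lt_succ_self M)]
        · simp [e]
        · simp [e.not_gt, e.ne', show ¬ j < M + 1 by omega]
      · intro hR
        refine ⟨∅, by simp, ?_⟩
        convert hR using 2 with j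
        rcases lt_trichotomy j M with e | e | e
        · simp [e, e.trans (Nat.lt_succ_self M)]
        · simp [e]
        · simp [e.not_gt, e.ne', show ¬ j < M + 1 by omega]
  obtain ⟨ψ, hψ⟩ := h
  refine (key (MSO.encode ψ + 1)).of_iff fun P v V => ?_
  rw [← hψ, ← hψ]
  refine MSO.sat_congr _ _ _ (fun _ _ => rfl) fun j hj => ?_
  have := MSO.le_encode_of_mem_fv2 ψ j hj
  simp [show j < MSO.encode ψ + 1 by omega]

theorem forall_mem_Ico {x y s : ℕ} (hx : x < s) (hy : y < s) (h : Expressible R) :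
    Expressible fun P v V => ∀ a ∈ Set.Ico (v x) (v y), R P (Function.update v s a) V :=
  (all1 s (imp ((le x s).and (lt s y)) h)).of_iff fun P v V => by
    simp [Function.update_of_ne hx.ne, Function.update_of_ne hy.ne]

theorem exists_mem_Ico {x y s : ℕ} (hx : x < s) (hy : y < s) (h : Expressible R) :
    Expressible fun P v V => ∃ a ∈ Set.Ico (v x) (v y), R P (Function.update v s a) V :=
  (ex1 s (and ((le x s).and (lt s y)) h)).of_iff fun P v V => by
    simp [Function.update_of_ne hx.ne, Function.update_of_ne hy.ne]

theorem tp_eq (m k x y x' y' : ℕ) : Expressible (p := p) fun P v V =>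
    tp P m (Set.Ico (v x) (v y)) k (fun i => V (2 * i)) =
      tp P m (Set.Ico (v x') (v y')) k (fun i => V (2 * i + 1)) := by
  obtain ⟨s, h1, h2, h3, h4⟩ : ∃ s, x < s ∧ y < s ∧ x' < s ∧ y' < s :=
    ⟨x + y + x' + y' + 1, by omega, by omega, by omega, by omega⟩
  induction k with
  | zero =>
    have sub : ∀ {x y : ℕ} (i j : ℕ), x < s → y < s → Expressible (p := p) fun _ v V =>
        ∀ a ∈ Set.Ico (v x) (v y), a ∈ V i → a ∈ V j := fun {x y} i j hx hy =>
      (forall_mem_Ico hx hy ((mem s i).imp (mem s j))).of_iff fun P v V => by simp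
    have ltt : ∀ {x y : ℕ} (i j : ℕ), x < s → y < s → Expressible (p := p) fun _ v V =>
        ∃ a ∈ Set.Ico (v x) (v y), ∃ b ∈ Set.Ico (v x) (v y), a < b ∧ a ∈ V i ∧ b ∈ V j :=
      fun {x y} i j hx hy =>
      (exists_mem_Ico hx hy (exists_mem_Ico (x := x) (y := y) (s := s + 1) (by omega) (by omega)
        ((lt s (s + 1)).and ((mem s i).and (mem (s + 1) j))))).of_iff fun P v V => by
          simp [Function.update_of_ne hx.ne, Function.update_of_ne hy.ne]
    have ne : ∀ {x y : ℕ} (i : ℕ), x < s → y < s → Expressible (p := p) fun _ v V =>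
        ∃ a ∈ Set.Ico (v x) (v y), a ∈ V i := fun {x y} i hx hy =>
      (exists_mem_Ico hx hy (mem s i)).of_iff fun P v V => by simp
    have subP : ∀ {x y : ℕ} (i : ℕ) (q : Fin p), x < s → y < s → Expressible (p := p) fun P v V =>
        ∀ a ∈ Set.Ico (v x) (v y), a ∈ V i → a ∈ P q := fun {x y} i q hx hy =>
      (forall_mem_Ico hx hy ((mem s i).imp (pred q s))).of_iff fun P v V => by simp
    refine ((forall_lt m fun i => forall_lt m fun j =>
      (sub (2 * i) (2 * j) h1 h2).iff (sub (2 * i + 1) (2 * j + 1) h3 h4)).and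
      ((forall_lt m fun i => forall_lt m fun j =>
        (ltt (2 * i) (2 * j) h1 h2).iff (ltt (2 * i + 1) (2 * j + 1) h3 h4)).and
      ((forall_lt m fun i => (ne (2 * i) h1 h2).iff (ne (2 * i + 1) h3 h4)).and
      (forall_lt m fun i => forall_fin fun q => (subP (2 * i) q h1 h2).iff
        (subP (2 * i + 1) q h3 h4))))).of_iff
        fun P v V => tp_zero_eq_iff.symm
  | succ k ih =>
    have upd : ∀ (V : ℕ → Set ℤ) (i : ℕ) (S S' : Set ℤ),
        (fun j => Function.update (Function.update V (2 * i) S) (2 * i + 1) S' (2 * j)) =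
          Function.update (fun j => V (2 * j)) i S ∧
        (fun j => Function.update (Function.update V (2 * i) S) (2 * i + 1) S' (2 * j + 1)) =
          Function.update (fun j => V (2 * j + 1)) i S' := by
      intro V i S S'
      constructor <;> ext1 j <;> by_cases e : j = i
      · subst e; simp
      · simp [e, show 2 * j ≠ 2 * i + 1 by omega]
      · subst e; simp
      · simp [e, show 2 * j + 1 ≠ 2 * i by omega]
    refine (ih.and (forall_lt m fun i => (all2 (2 * i) (ex2 (2 * i + 1) ih)).and
      (all2 (2 * i + 1) (ex2 (2 * i) ih)))).of_iff fun P v V => ?_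
    rw [tp_succ_eq_iff]
    refine and_congr_right fun _ => forall₂_congr fun i _ => and_congr ?_ ?_
    · simp only [(upd _ _ _ _).1, (upd _ _ _ _).2]
    · simp only [Function.update_comm (show 2 * i + 1 ≠ 2 * i by omega), (upd _ _ _ _).1,
        (upd _ _ _ _).2]

theorem segTp_eq (m k x y x' y' : ℕ) : Expressible (p := p) fun P v _ =>
    segTp P m k (v x) (v y) = segTp P m k (v x') (v y') :=
  (tp_eq m k x y x' y').empty

theorem segRecurs (m k : ℕ) : Expressible (p := p) fun P v _ =>
    SegRecurs P m k (v 0) (v 1) (v 2) (v 3) (v 4) := by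
  have hR := ex1 (p := p) 5 ((le 0 5).and ((lt 4 5).and ((segTp_eq m k 4 5 4 2).and
    (ex1 6 ((le 5 6).and (segTp_eq m k 4 6 5 6))))))
  have hL := ex1 (p := p) 5 ((le 5 0).and ((lt 5 3).and ((segTp_eq m k 5 3 1 3).and
    (ex1 6 ((le 6 5).and (segTp_eq m k 6 3 6 5))))))
  exact (hR.and hL).of_iff fun P v V => by simp [SegRecurs]

end Expressible

end Paper

namespace Paper

/-! ### Conditions, forcing and generic sets -/

/-- `X` and `Z` agree on the interval `[l, u)`. -/
def Agree (l u : ℤ) (X Z : Set ℤ) : Prop := ∀ x, l ≤ x → x < u → (x ∈ X ↔ x ∈ Z)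

/-- A condition prescribes the trace of a set of integers on the interval `[l, u)`. -/
structure Cond where
  /-- The left end of the interval. -/
  l : ℤ
  /-- The right end of the interval. -/
  u : ℤ
  /-- The prescribed set. -/
  Z : Set ℤ

namespace Cond

/-- The set `X` satisfies the condition `q`. -/
def In (q : Cond) (X : Set ℤ) : Prop := Agree q.l q.u X q.Z

/-- The condition `r` extends `q`. -/
def Ext (r q : Cond) : Prop := r.l ≤ q.l ∧ q.u ≤ r.u ∧ Agree q.l q.u r.Z q.Z

theorem Ext.refl (q : Cond) : q.Ext q := ⟨le_rfl, le_rfl, fun _ _ _ => Iff.rfl⟩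

theorem Ext.trans {s r q : Cond} (h : s.Ext r) (h' : r.Ext q) : s.Ext q :=
  ⟨h.1.trans h'.1, h'.2.1.trans h.2.1, fun x h1 h2 =>
    (h.2.2 x (h'.1.trans h1) (h2.trans_le h'.2.1)).trans (h'.2.2 x h1 h2)⟩

theorem Ext.in_of_in {r q : Cond} (h : r.Ext q) {X : Set ℤ} (hX : r.In X) : q.In X :=
  fun x h1 h2 => (hX x (h.1.trans h1) (h2.trans_le h.2.1)).trans (h.2.2 x h1 h2)

/-- The trace of `Q` on the convex hull of the intervals of `q` and `r`. -/
def hull (Q : Set ℤ) (q r : Cond) : Cond := ⟨min q.l r.l, max q.u r.u, Q⟩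

theorem hull_in (Q : Set ℤ) (q r : Cond) : (hull Q q r).In Q := fun _ _ _ => Iff.rfl

theorem hull_ext_left {Q : Set ℤ} {q : Cond} (h : q.In Q) (r : Cond) : (hull Q q r).Ext q :=
  ⟨min_le_left _ _, le_max_left _ _, h⟩

theorem hull_ext_right {Q : Set ℤ} (q : Cond) {r : Cond} (h : r.In Q) : (hull Q q r).Ext r :=
  ⟨min_le_right _ _, le_max_right _ _, h⟩

end Cond

/-- Below `q` the requirements `G N` are dense, and they imply `A`. -/
def Force (G : ℤ → Set ℤ → Prop) (A : Set ℤ → Prop) (q : Cond) : Prop :=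
  (∀ N, ∀ r : Cond, r.Ext q → ∃ s : Cond, s.Ext r ∧ ∀ X, s.In X → G N X) ∧
    ∀ X, q.In X → (∀ N, G N X) → A X

theorem Force.mono {G : ℤ → Set ℤ → Prop} {A : Set ℤ → Prop} {q r : Cond} (h : Force G A q)
    (hr : r.Ext q) : Force G A r :=
  ⟨fun N s hs => h.1 N s (hs.trans hr), fun X hX => h.2 X (hr.in_of_in hX)⟩

/-- The assignment listing `l`, extended by zero. -/
def asg (l : List ℤ) : ℕ → ℤ := fun i => l.getD i 0

/-- The truth of `ψ` with parameters `l` in the expansion by `X`. -/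
def SatX {n : ℕ} (P : Fin n → Set ℤ) (ψ : MSO (n + 1)) (l : List ℤ) (X : Set ℤ) : Prop :=
  ZSat (Fin.snoc P X : Fin (n + 1) → Set ℤ) (asg l) (fun _ => ∅) ψ

/-- The condition `q` decides the property `A`. -/
def Decides (A : Set ℤ → Prop) (q : Cond) : Prop :=
  (∀ X, q.In X → A X) ∨ ∀ r : Cond, r.Ext q → ∃ X, r.In X ∧ ¬ A X

theorem Decides.mono {A : Set ℤ → Prop} {q r : Cond} (h : Decides A q) (hr : r.Ext q) :
    Decides A r :=
  h.imp (fun h X hX => h X (hr.in_of_in hX)) fun h s hs => h s (hs.trans hr)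

theorem exists_ext_decides (A : Set ℤ → Prop) (q : Cond) : ∃ r : Cond, r.Ext q ∧ Decides A r := by
  by_cases h : ∃ r : Cond, r.Ext q ∧ ∀ X, r.In X → A X
  · obtain ⟨r, hr, h⟩ := h
    exact ⟨r, hr, Or.inl h⟩
  · push Not at h
    exact ⟨q, .refl q, Or.inr h⟩

/-- Every property expressed by a formula with parameters is decided by a condition in `Q`. -/
def Generic {n : ℕ} (P : Fin n → Set ℤ) (Q : Set ℤ) : Prop :=
  ∀ (ψ : MSO (n + 1)) (l : List ℤ), ∃ q : Cond, q.In Q ∧ Decides (SatX P ψ l) q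

section Generic

variable {n : ℕ} {P : Fin n → Set ℤ} {Q : Set ℤ}

theorem Generic.not_definable (h : Generic P Q) :
    ¬ MSO.Definable (fun x y : ℤ => x < y) P Q := by
  rintro ⟨φ, h1, h2, hφ⟩
  let ψ : MSO (n + 1) := .ex1 0 (.not (.iff (.lift φ) (.pred (Fin.last n) 0)))
  have hψ : ∀ X, SatX P ψ [] X ↔ X ≠ Q := by
    intro X
    have : ∀ a, ZSat P (Function.update (asg []) 0 a) (fun _ => ∅) φ ↔ a ∈ Q := by
      refine fun a => ⟨fun h => (hφ a).2 fun v V => ?_, fun h => (hφ a).1 h _ _⟩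
      refine (MSO.sat_congr _ _ φ (fun i hi => ?_) (fun j hj => ?_)).1 h
      · have := Finset.mem_singleton.1 (h1 hi)
        subst this
        simp
      · simp [h2] at hj
    simp only [SatX, ψ, MSO.Sat, MSO.sat_iff, MSO.sat_lift, this, Fin.snoc_last,
      Function.update_self, Ne, Set.ext_iff, not_forall]
    exact exists_congr fun a => not_congr Iff.comm
  obtain ⟨q, hq, h | h⟩ := h ψ []
  · exact (hψ Q).1 (h Q hq) rfl
  · let r : Cond := ⟨q.l, max q.l q.u + 1, {x | (x < max q.l q.u ∧ x ∈ Q) ∨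
      (x = max q.l q.u ∧ x ∉ Q)}⟩
    obtain ⟨X, hX, hXQ⟩ := h r ⟨le_rfl, by simp only [r]; omega, fun x h1 h2 => by
      have : x < max q.l q.u := h2.trans_le (le_max_right _ _)
      rw [← hq x h1 h2]
      simp only [r, Set.mem_ofPred_eq, this, this.ne, true_and, false_and, or_false]⟩
    rw [hψ, ne_eq, not_not] at hXQ
    subst hXQ
    have := hX (max q.l q.u) (le_max_left _ _) (by simp only [r]; omega)
    simp only [r, Set.mem_ofPred_eq, lt_irrefl, false_and, false_or, true_and] at this
    tauto

theorem Generic.of_force (h : Generic P Q) {γ : MSO (n + 1)} {a b c d : ℤ}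
    {A : Set ℤ → Prop} {q : Cond} (hq : q.In Q)
    (hF : Force (fun N => SatX P γ [N, a, b, c, d]) A q) : A Q := by
  refine hF.2 Q hq fun N => ?_
  obtain ⟨r, hr, h | h⟩ := h γ [N, a, b, c, d]
  · exact h Q hr
  · obtain ⟨s, hs, hsG⟩ := hF.1 N (q.hull Q r) (Cond.hull_ext_left hq r)
    obtain ⟨X, hX, hXG⟩ := h s (hs.trans (Cond.hull_ext_right q hr))
    exact absurd (hsG X hX) hXG

theorem SegRecurs.exists_interval {p : ℕ} {P : Fin p → Set ℤ} {m k : ℕ} {N a b c d : ℤ}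
    (h : SegRecurs P m k N a b c d) : ∃ l u, ∀ P' : Fin p → Set ℤ,
      (∀ x, l ≤ x → x < u → ∀ q, x ∈ P q ↔ x ∈ P' q) → SegRecurs P' m k N a b c d := by
  obtain ⟨⟨j, h1, h2, h3, z, h4, h5⟩, j', h1', h2', h3', z', h4', h5'⟩ := h
  refine ⟨min (min d a) z', max (max b c) z, fun P' hP' => ?_⟩
  have e : ∀ x y, min (min d a) z' ≤ x → y ≤ max (max b c) z →
      segTp P m k x y = segTp P' m k x y := fun x y hx hy =>
    tp_congr k (fun t ht => hP' t (hx.trans ht.1) (ht.2.trans_le hy)) fun _ _ _ => Iff.rfl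
  rw [e d j (by omega) (by omega), e d b (by omega) (by omega)] at h3
  rw [e d z (by omega) (by omega), e j z (by omega) (by omega)] at h5
  rw [e j' c (by omega) (by omega), e a c (by omega) (by omega)] at h3'
  rw [e z' c (by omega) (by omega), e z' j' (by omega) (by omega)] at h5'
  exact ⟨⟨j, h1, h2, h3, z, h4, h5⟩, j', h1', h2', h3', z', h4', h5'⟩

theorem snoc_agree {l u : ℤ} {X Y : Set ℤ} (h : Agree l u X Y) (x : ℤ) (hl : l ≤ x) (hu : x < u)
    (q : Fin (n + 1)) : x ∈ (Fin.snoc P X : Fin (n + 1) → Set ℤ) q ↔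
      x ∈ (Fin.snoc P Y : Fin (n + 1) → Set ℤ) q := by
  refine Fin.lastCases ?_ (fun i => ?_) q
  · simpa using h x hl hu
  · simp

open Expressible in
theorem exists_formula_not_dense {γ : MSO (n + 1)}
    {R : (Fin (n + 1) → Set ℤ) → ℤ → ℤ → ℤ → ℤ → ℤ → Prop}
    (hγ : ∀ P v V, ZSat P v V γ ↔ R P (v 0) (v 1) (v 2) (v 3) (v 4)) :
    ∃ ψ : MSO (n + 1), ∀ (P : Fin n → Set ℤ) (a b c d : ℤ) (X : Set ℤ),
      SatX P ψ [0, a, b, c, d] X ↔ ∃ l u N, ∀ s : Cond, s.Ext ⟨l, u, X⟩ →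
        ∃ Y, s.In Y ∧ ¬ R (Fin.snoc P Y : Fin (n + 1) → Set ℤ) N a b c d := by
  have hR : Expressible fun P v V =>
      R (Fin.snoc (Fin.init P) (V 0) : Fin (n + 1) → Set ℤ) (v 0) (v 1) (v 2) (v 3) (v 4) := by
    refine ⟨.lift (.tr γ), fun P v V => ?_⟩
    conv_lhs => rw [← Fin.snoc_init_self P]
    rw [MSO.sat_lift, MSO.sat_tr, hγ]
  have ext := (le (p := n + 1) 7 5).and ((le 6 8).and
    (all1 9 ((le 5 9).imp ((lt 9 6).imp ((mem 9 1).iff (pred (Fin.last n) 9))))))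
  have inn := (all1 9 ((le (p := n + 1) 7 9).imp ((lt 9 8).imp ((mem 9 0).iff (mem 9 1)))))
  obtain ⟨ψ, hψ⟩ := ex1 5 (ex1 6 (ex1 0 (all2 1 (all1 7 (all1 8
    (ext.imp (ex2 0 (inn.and hR.not))))))))
  refine ⟨ψ, fun P a b c d X => ?_⟩
  rw [SatX, hψ]
  refine exists_congr fun l => exists_congr fun u => exists_congr fun N => ?_
  simp [asg, Cond.Ext, Cond.In, Agree]
  constructor
  · intro h s h1 h2 h3
    exact h s.Z s.l s.u h1 h2 h3
  · intro h S l' u' h1 h2 h3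
    exact h ⟨l', u', S⟩ h1 h2 h3

theorem Generic.exists_force (h : Generic P Q) {φ : MSO (n + 1)} (hφ : φ.IsSentence)
    (hQ : SatX P φ [] Q) : ∃ (γ : MSO (n + 1)) (a b c d : ℤ) (q : Cond), q.In Q ∧
      Force (fun N => SatX P (.close 5 γ) [N, a, b, c, d]) (SatX P φ []) q := by
  let m := 2 * MSO.encode φ + 2
  let k := MSO.qd φ
  obtain ⟨γ, hγ⟩ := Expressible.segRecurs (p := n + 1) m k
  obtain ⟨a, b, c, d, hac, hcd, hdb, hrec⟩ :=
    exists_segRecurs (Fin.snoc P Q : Fin (n + 1) → Set ℤ) m k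
  have hG : ∀ N X, SatX P (.close 5 γ) [N, a, b, c, d] X ↔
      SegRecurs (Fin.snoc P X : Fin (n + 1) → Set ℤ) m k N a b c d := by
    intro N X
    rw [SatX, MSO.sat_close, hγ]
    · rfl
    · intro v v' V V' hv
      rw [hγ, hγ]
      simp only [hv 0 (by omega), hv 1 (by omega), hv 2 (by omega), hv 3 (by omega),
        hv 4 (by omega)]
  obtain ⟨ψ, hψ⟩ := exists_formula_not_dense hγ
  obtain ⟨q, hq, hd | hd⟩ := h ψ [0, a, b, c, d]
  · exfalso
    obtain ⟨l, u, N, hN⟩ := (hψ P a b c d Q).1 (hd Q hq)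
    obtain ⟨l', u', hopen⟩ := (hrec N).exists_interval
    obtain ⟨Y, hY, hYG⟩ := hN (Cond.hull Q ⟨l, u, Q⟩ ⟨l', u', Q⟩)
      (Cond.hull_ext_left (fun _ _ _ => Iff.rfl) _)
    refine hYG (hopen _ fun x h1 h2 => snoc_agree (l := l') (u := u') (fun y h1 h2 => ?_) x h1 h2)
    exact (hY y ((min_le_right _ _).trans h1) (h2.trans_le (le_max_right _ _))).symm
  · refine ⟨γ, a, b, c, d, Cond.hull Q q ⟨a, b, Q⟩, Cond.hull_in _ _ _, fun N r hr => ?_,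
      fun X hX hXG => ?_⟩
    · obtain ⟨X, hX, hXO⟩ := hd r (hr.trans (Cond.hull_ext_left hq _))
      rw [hψ] at hXO
      push Not at hXO
      obtain ⟨s, hs, hsG⟩ := hXO r.l r.u N
      refine ⟨s, hs.trans ⟨le_rfl, le_rfl, hX⟩, fun Y hY => (hG N Y).2 (hsG Y hY)⟩
    · have e : ∀ x y, a ≤ x → y ≤ b →
          segTp (Fin.snoc P X : Fin (n + 1) → Set ℤ) m k x y =
            segTp (Fin.snoc P Q : Fin (n + 1) → Set ℤ) m k x y := by
        refine fun x y hx hy => tp_congr k (fun t ht => ?_) fun _ _ _ => Iff.rfl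
        exact snoc_agree hX t ((min_le_right _ _).trans (hx.trans ht.1))
          ((ht.2.trans_le hy).trans_le (le_max_right _ _))
      have := tp_univ_eq hcd (fun N => (hG N X).1 (hXG N)) hrec (e a c (by omega) (by omega))
        (e c d (by omega) (by omega)) (e d b (by omega) (by omega))
      refine (sat_iff_of_tp_eq φ le_rfl (show 2 * MSO.encode φ + 1 < m by simp only [m]; omega)
        ?_ ?_ this).2 hQ
      · simp [hφ.1]
      · simp [hφ.2]

end Generic

end Paper

namespace Paper

/-! ### Formulas speaking about conditions

The condition `⟨x₅, x₆, X₁⟩` is the one under consideration; the other conditions are quantified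
as `⟨x₇, x₈, X₂⟩` and `⟨x₉, x₁₀, X₃⟩`. -/

namespace MSO

variable {n : ℕ}

/-- The formula `xᵢ = xⱼ`. -/
def eq (i j : ℕ) : MSO n := .and (.le i j) (.le j i)

/-- `Xᵢ` and `Xⱼ` agree on `[x_l, x_u)`. -/
def agreeF (l u i j : ℕ) : MSO n :=
  .all1 19 (.imp (.le l 19) (.imp (.lt 19 u) (.iff (.mem 19 i) (.mem 19 j))))

/-- One condition extends another. -/
def extF (l' u' i l u j : ℕ) : MSO n := .and (.le l' l) (.and (.le u u') (agreeF l u i j))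

/-- The formula expressing `Force`. -/
def forceF (γ φ : MSO n) : MSO n :=
  .and
    (.all1 0 (.all1 7 (.all1 8 (.all2 2 (.imp (extF 7 8 2 5 6 1)
      (.ex1 9 (.ex1 10 (.ex2 3 (.and (extF 9 10 3 7 8 2)
        (.all2 0 (.imp (agreeF 9 10 0 3) γ)))))))))))
    (.all2 0 (.imp (agreeF 5 6 0 1) (.imp (.all1 0 γ) φ)))

/-- The formula expressing `Force` for some parameters. -/
def frcF (γ φ : MSO n) : MSO n := .ex1 1 (.ex1 2 (.ex1 3 (.ex1 4 (forceF γ φ))))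

/-- The formula stating that some condition in `σ` forces `φ`. -/
def searchF (σ γ φ : MSO n) : MSO n := .ex1 5 (.ex1 6 (.ex2 1 (.and σ (frcF γ φ))))

/-- The formula `σ` read at `⟨x₇, x₈, X₂⟩`. -/
def shiftF (σ : MSO n) : MSO n :=
  .ex1 5 (.ex1 6 (.ex2 1 (.and (.eq 5 7) (.and (.eq 6 8)
    (.and (.all1 19 (.iff (.mem 19 1) (.mem 19 2))) σ)))))

/-- The formula expressing `Decides`. -/
def decidesF (ψ : MSO n) : MSO n :=
  .or (.all2 0 (.imp (agreeF 5 6 0 1) ψ))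
    (.all1 7 (.all1 8 (.all2 2 (.imp (extF 7 8 2 5 6 1)
      (.ex2 0 (.and (agreeF 7 8 0 2) (.not ψ)))))))

/-- The condition decides `ψ` and properly extends a condition in `σ`. -/
def widerF (σ ψ : MSO n) : MSO n :=
  .and (.ex1 7 (.ex1 8 (.ex2 2 (.and (shiftF σ)
    (.and (.lt 5 7) (.and (.lt 8 6) (extF 5 6 1 7 8 2))))))) (decidesF ψ)

/-- The condition `⟨x₅, x₆, X₁⟩` precedes or equals `⟨x₇, x₈, X₂⟩`. -/
def precedesF : MSO n :=
  .or (.lt 6 8) (.and (.eq 6 8) (.or (.lt 7 5) (.and (.eq 5 7) (.or (agreeF 5 6 1 2)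
    (.ex1 9 (.and (.le 5 9) (.and (.lt 9 6) (.and (.not (.mem 9 1)) (.and (.mem 9 2)
      (agreeF 5 9 1 2))))))))))

/-- The condition is the first one in `σ`. -/
def leastF (σ : MSO n) : MSO n :=
  .and σ (.all1 7 (.all1 8 (.all2 2 (.imp (shiftF σ) precedesF))))

/-- The formula selecting the next condition of the generic sequence. -/
def stepF (σ ψ : MSO n) : MSO n := leastF (widerF σ ψ)

section fv

variable (φ ψ : MSO n) (i : ℕ)

theorem fv1_or : fv1 (.or φ ψ) = fv1 φ ∪ fv1 ψ := rfl
theorem fv1_imp : fv1 (.imp φ ψ) = fv1 φ ∪ fv1 ψ := rfl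
theorem fv1_iff : fv1 (.iff φ ψ) = fv1 φ ∪ fv1 ψ ∪ (fv1 ψ ∪ fv1 φ) := rfl
theorem fv1_all1 : fv1 (.all1 i φ) = fv1 φ \ {i} := rfl
theorem fv1_all2 : fv1 (.all2 i φ) = fv1 φ := rfl
theorem fv1_le (j : ℕ) : fv1 (.le i j : MSO n) = {j, i} := rfl
theorem fv1_eq (j : ℕ) : fv1 (.eq i j : MSO n) = {j, i} ∪ {i, j} := rfl
theorem fv2_or : fv2 (.or φ ψ) = fv2 φ ∪ fv2 ψ := rfl
theorem fv2_imp : fv2 (.imp φ ψ) = fv2 φ ∪ fv2 ψ := rfl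
theorem fv2_iff : fv2 (.iff φ ψ) = fv2 φ ∪ fv2 ψ ∪ (fv2 ψ ∪ fv2 φ) := rfl
theorem fv2_all1 : fv2 (.all1 i φ) = fv2 φ := rfl
theorem fv2_all2 : fv2 (.all2 i φ) = fv2 φ \ {i} := rfl
theorem fv2_le (j : ℕ) : fv2 (.le i j : MSO n) = ∅ := rfl
theorem fv2_eq (j : ℕ) : fv2 (.eq i j : MSO n) = ∅ := rfl

end fv

theorem isSentence_searchF {σ γ φ : MSO n} (hσ1 : fv1 σ ⊆ {5, 6}) (hσ2 : fv2 σ ⊆ {1})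
    (hγ1 : ∀ i ∈ fv1 γ, i < 5) (hγ2 : fv2 γ ⊆ {0}) (hφ1 : fv1 φ = ∅) (hφ2 : fv2 φ ⊆ {0}) :
    (searchF σ γ φ).IsSentence := by
  constructor
  · ext x
    have h1 := @hσ1 x
    have h2 := hγ1 x
    simp only [searchF, frcF, forceF, extF, agreeF, fv1, fv1_imp, fv1_iff, fv1_all1, fv1_all2,
      fv1_le, hφ1, Finset.mem_union, Finset.mem_sdiff, Finset.mem_insert, Finset.mem_singleton,
      Finset.notMem_empty] at h1 ⊢
    grind
  · ext x
    have h1 := @hσ2 x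
    have h2 := @hγ2 x
    have h3 := @hφ2 x
    simp only [searchF, frcF, forceF, extF, agreeF, fv2, fv2_imp, fv2_iff, fv2_all1, fv2_all2,
      fv2_le, Finset.mem_union, Finset.mem_sdiff, Finset.mem_singleton,
      Finset.notMem_empty] at h1 h2 h3 ⊢
    grind

theorem fv1_stepF {σ ψ : MSO n} (hσ : fv1 σ ⊆ {5, 6}) (hψ : fv1 ψ = ∅) :
    fv1 (stepF σ ψ) ⊆ {5, 6} := by
  intro x
  have h1 := @hσ x
  simp only [stepF, leastF, widerF, precedesF, shiftF, decidesF, extF, agreeF, fv1, fv1_imp,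
    fv1_iff, fv1_all1, fv1_all2, fv1_le, fv1_eq, fv1_or, hψ, Finset.mem_union, Finset.mem_sdiff,
    Finset.mem_insert, Finset.mem_singleton, Finset.notMem_empty] at h1 ⊢
  grind

theorem fv2_stepF {σ ψ : MSO n} (hσ : fv2 σ ⊆ {1}) (hψ : fv2 ψ ⊆ {0}) :
    fv2 (stepF σ ψ) ⊆ {1} := by
  intro x
  have h1 := @hσ x
  have h2 := @hψ x
  simp only [stepF, leastF, widerF, precedesF, shiftF, decidesF, extF, agreeF, fv2, fv2_imp,
    fv2_iff, fv2_all1, fv2_all2, fv2_le, fv2_eq, fv2_or, Finset.mem_union, Finset.mem_sdiff,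
    Finset.mem_singleton, Finset.notMem_empty] at h1 h2 ⊢
  grind

end MSO

section semantics

variable {n : ℕ} {P : Fin n → Set ℤ}

open MSO

theorem Cond.forall_iff {F : Cond → Prop} : (∀ q, F q) ↔ ∀ l u Z, F ⟨l, u, Z⟩ :=
  ⟨fun h _ _ _ => h _, fun h q => h q.l q.u q.Z⟩

theorem Cond.exists_iff {F : Cond → Prop} : (∃ q, F q) ↔ ∃ l u Z, F ⟨l, u, Z⟩ :=
  ⟨fun ⟨q, h⟩ => ⟨q.l, q.u, q.Z, h⟩, fun ⟨_, _, _, h⟩ => ⟨_, h⟩⟩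

/-- The formula `σ` defines the set `S` of conditions. -/
def DefinesCond (P : Fin n → Set ℤ) (σ : MSO n) (S : Cond → Prop) : Prop :=
  ∀ v V, ZSat P v V σ ↔ S ⟨v 5, v 6, V 1⟩

/-- The formula `ψ` defines the class `A` of sets. -/
def DefinesClass (P : Fin n → Set ℤ) (ψ : MSO n) (A : Set ℤ → Prop) : Prop :=
  ∀ v V, ZSat P v V ψ ↔ A (V 0)

@[simp] theorem sat_eq (v : ℕ → ℤ) (V : ℕ → Set ℤ) (i j : ℕ) :
    ZSat P v V (.eq i j) ↔ v i = v j := by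
  simp [MSO.eq, Sat, le_antisymm_iff]

theorem sat_agreeF (v : ℕ → ℤ) (V : ℕ → Set ℤ) {l u : ℕ} (i j : ℕ) (hl : l < 19) (hu : u < 19) :
    ZSat P v V (agreeF l u i j) ↔ Agree (v l) (v u) (V i) (V j) := by
  simp [agreeF, Sat, Agree, hl.ne, hu.ne]

theorem sat_extF (v : ℕ → ℤ) (V : ℕ → Set ℤ) {l u : ℕ} (l' u' i j : ℕ) (hl : l < 19)
    (hu : u < 19) : ZSat P v V (extF l' u' i l u j) ↔
      Cond.Ext ⟨v l', v u', V i⟩ ⟨v l, v u, V j⟩ := by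
  simp [extF, Sat, sat_agreeF _ _ _ _ hl hu, Cond.Ext]

theorem definesCond_frcF {γ φ : MSO n} {G : ℤ → ℤ → ℤ → ℤ → ℤ → Set ℤ → Prop} {A : Set ℤ → Prop}
    (hγ : ∀ v V, ZSat P v V γ ↔ G (v 0) (v 1) (v 2) (v 3) (v 4) (V 0))
    (hφ : DefinesClass P φ A) : DefinesCond P (frcF γ φ) fun q =>
      ∃ a b c d, Force (fun N => G N a b c d) A q := by
  intro v V
  refine exists_congr fun a => exists_congr fun b => exists_congr fun c => exists_congr fun d => ?_
  simp [forceF, Sat, sat_agreeF, sat_extF, hγ, hφ _ _, Force, Cond.forall_iff,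
    Cond.exists_iff, Cond.In]

theorem sat_searchF {σ γ φ : MSO n} {S F : Cond → Prop} (hσ : DefinesCond P σ S)
    (hF : DefinesCond P (frcF γ φ) F) (v : ℕ → ℤ) (V : ℕ → Set ℤ) :
    ZSat P v V (searchF σ γ φ) ↔ ∃ q, S q ∧ F q := by
  simp [searchF, Sat, hσ _ _, hF _ _, Cond.exists_iff]

theorem sat_shiftF {σ : MSO n} {S : Cond → Prop} (hσ : DefinesCond P σ S) (v : ℕ → ℤ)
    (V : ℕ → Set ℤ) : ZSat P v V (shiftF σ) ↔ S ⟨v 7, v 8, V 2⟩ := by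
  simp only [shiftF, Sat, sat_eq, sat_all1, sat_iff, hσ _ _]
  simp [← Set.ext_iff]

theorem definesCond_decidesF {ψ : MSO n} {A : Set ℤ → Prop} (hψ : DefinesClass P ψ A) :
    DefinesCond P (decidesF ψ) (Decides A) := by
  intro v V
  simp [decidesF, Sat, sat_agreeF, sat_extF, hψ _ _, Decides, Cond.forall_iff, Cond.In]

/-- The condition `q` decides `A` and properly extends a condition in `S`. -/
def Wider (S : Cond → Prop) (A : Set ℤ → Prop) (q : Cond) : Prop :=
  (∃ r, S r ∧ q.l < r.l ∧ r.u < q.u ∧ q.Ext r) ∧ Decides A q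

theorem definesCond_widerF {σ ψ : MSO n} {S : Cond → Prop} {A : Set ℤ → Prop}
    (hσ : DefinesCond P σ S) (hψ : DefinesClass P ψ A) :
    DefinesCond P (widerF σ ψ) (Wider S A) := by
  intro v V
  simp [widerF, Sat, sat_shiftF hσ, definesCond_decidesF hψ _ _, sat_extF, Wider,
    Cond.exists_iff]

/-- The condition `q` precedes or equals `r`. -/
def Precedes (q r : Cond) : Prop :=
  q.u < r.u ∨ q.u = r.u ∧ (r.l < q.l ∨ q.l = r.l ∧ (Agree q.l q.u q.Z r.Z ∨
    ∃ x, q.l ≤ x ∧ x < q.u ∧ x ∉ q.Z ∧ x ∈ r.Z ∧ Agree q.l x q.Z r.Z))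

/-- The condition `q` is the first one in `S`. -/
def Least (S : Cond → Prop) (q : Cond) : Prop := S q ∧ ∀ r, S r → Precedes q r

theorem definesCond_stepF {σ ψ : MSO n} {S : Cond → Prop} {A : Set ℤ → Prop}
    (hσ : DefinesCond P σ S) (hψ : DefinesClass P ψ A) :
    DefinesCond P (stepF σ ψ) (Least (Wider S A)) := by
  intro v V
  have h := definesCond_widerF hσ hψ
  simp [stepF, leastF, precedesF, Sat, sat_shiftF h, h _ _, sat_agreeF, Least, Precedes,
    Cond.forall_iff]

end semantics

end Paper

namespace Paper

/-! ### Construction of a generic set -/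

section

variable {n : ℕ} {P : Fin n → Set ℤ}

open MSO

theorem definesClass_tr (P : Fin n → Set ℤ) {φ : MSO (n + 1)} (hφ : φ.IsSentence) :
    DefinesClass P (tr φ) (SatX P φ []) := by
  intro v V
  rw [sat_tr]
  exact sat_congr _ _ _ (by simp [hφ.1]) (by simp [hφ.2])

theorem isSentence_close (φ : MSO n) : (close 0 φ).IsSentence :=
  ⟨fv1_close_zero φ, fv2_close 0 φ⟩

/-- The condition `q` forces `φ` by means of `γ` and some parameters. -/
def Frc (P : Fin n → Set ℤ) (γ φ : MSO (n + 1)) (q : Cond) : Prop :=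
  ∃ a b c d, Force (fun N => SatX P (.close 5 γ) [N, a, b, c, d]) (SatX P φ []) q

theorem Frc.mono {γ φ : MSO (n + 1)} {q r : Cond} (h : Frc P γ φ q) (hr : r.Ext q) :
    Frc P γ φ r := by
  obtain ⟨a, b, c, d, h⟩ := h
  exact ⟨a, b, c, d, h.mono hr⟩

theorem definesCond_frc (P : Fin n → Set ℤ) (γ : MSO (n + 1)) {φ : MSO (n + 1)}
    (hφ : φ.IsSentence) : DefinesCond P (frcF (tr (close 5 γ)) (tr φ)) (Frc P γ φ) := by
  refine definesCond_frcF (G := fun N a b c d => SatX P (.close 5 γ) [N, a, b, c, d])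
    (fun v V => ?_) (definesClass_tr P hφ)
  rw [sat_tr]
  refine sat_congr _ _ _ (fun i hi => ?_) (by simp)
  have := lt_of_mem_fv1_close hi
  interval_cases i <;> rfl

theorem Cond.ext_of_le {q : ℕ → Cond} (hq : ∀ i, (q (i + 1)).Ext (q i)) {i j : ℕ} (h : i ≤ j) :
    (q j).Ext (q i) := by
  induction h with
  | refl => exact .refl _
  | step _ ih => exact (hq _).trans ih

theorem Cond.exists_in_of_chain {q : ℕ → Cond} (hq : ∀ i, (q (i + 1)).Ext (q i)) :
    ∃ Q, ∀ i, (q i).In Q := by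
  refine ⟨{x | ∃ i, (q i).l ≤ x ∧ x < (q i).u ∧ x ∈ (q i).Z}, fun i x h1 h2 => ⟨?_, fun h =>
    ⟨i, h1, h2, h⟩⟩⟩
  rintro ⟨j, h1', h2', h⟩
  have hi := (ext_of_le hq (le_max_left i j)).2.2 x h1 h2
  have hj := (ext_of_le hq (le_max_right i j)).2.2 x h1' h2'
  exact hi.1 (hj.2 h)

theorem exists_meets_dense {F : ℕ → Cond → Prop} (hF : ∀ i q, ∃ r : Cond, r.Ext q ∧ F i r) :
    ∃ Q, ∀ i, ∃ q : Cond, q.In Q ∧ F i q := by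
  choose f hf using hF
  let q : ℕ → Cond := fun i => Nat.rec ⟨0, 0, ∅⟩ (fun i r => f i r) i
  obtain ⟨Q, hQ⟩ := Cond.exists_in_of_chain (q := q) fun i => (hf i (q i)).1
  exact ⟨Q, fun i => ⟨q (i + 1), hQ (i + 1), (hf i (q i)).2⟩⟩

/-- Every nonempty definable set of integers is unbounded above. -/
def Unb (P : Fin n → Set ℤ) : Prop :=
  ∀ (ψ : MSO n) (D : Set ℤ), (∀ v V, ZSat P v V ψ ↔ v 5 ∈ D) → D.Nonempty → ¬ BddAbove D

theorem Unb.exists_ext_frc (h : Unb P) {γ φ : MSO (n + 1)} (hφ : φ.IsSentence) {q₀ : Cond}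
    (hq₀ : Frc P γ φ q₀) (r : Cond) : ∃ s : Cond, s.Ext r ∧ Frc P γ φ s := by
  have hD := h (.ex1 6 (.ex2 1 (frcF (tr (close 5 γ)) (tr φ)))) {l | ∃ u Z, Frc P γ φ ⟨l, u, Z⟩}
    (fun v V => by simp [Sat, definesCond_frc P γ hφ _ _]) ⟨q₀.l, q₀.u, q₀.Z, hq₀⟩
  rw [not_bddAbove_iff] at hD
  obtain ⟨l, ⟨u, Z, hZ⟩, hl⟩ := hD r.u
  refine ⟨⟨min r.l l, max r.u u, {x | (x < r.u ∧ x ∈ r.Z) ∨ (r.u ≤ x ∧ x ∈ Z)}⟩,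
    ⟨min_le_left _ _, le_max_left _ _, fun x h1 h2 => ?_⟩,
    hZ.mono ⟨min_le_right _ _, le_max_right _ _, fun x h1 h2 => ?_⟩⟩
  · simp [h2, h2.not_ge]
  · simp only at h1
    have : r.u ≤ x := by omega
    simp [this, this.not_gt]

theorem Unb.exists_generic (h : Unb P) (hc : Countable (MSO (n + 1))) :
    ∃ Q, Generic P Q ∧ ∀ γ φ, φ.IsSentence → (∃ q, Frc P γ φ q) → ∃ q, q.In Q ∧ Frc P γ φ q := by
  let ι := (MSO (n + 1) × List ℤ) ⊕ (MSO (n + 1) × MSO (n + 1))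
  have : Nonempty ι := ⟨.inl (.lt 0 0, [])⟩
  obtain ⟨f, hf⟩ := exists_surjective_nat ι
  let F : ι → Cond → Prop := Sum.elim (fun x => Decides (SatX P x.1 x.2))
    fun x q => x.2.IsSentence → (∃ q, Frc P x.1 x.2 q) → Frc P x.1 x.2 q
  obtain ⟨Q, hQ⟩ := exists_meets_dense (F := fun i => F (f i)) fun i q => by
    rcases f i with ⟨ψ, l⟩ | ⟨γ, φ⟩
    · exact exists_ext_decides _ q
    · by_cases hφ : φ.IsSentence ∧ ∃ q, Frc P γ φ q
      · obtain ⟨hφ, q₀, hq₀⟩ := hφ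
        obtain ⟨s, hs, hsF⟩ := h.exists_ext_frc hφ hq₀ q
        exact ⟨s, hs, fun _ _ => hsF⟩
      · exact ⟨q, .refl q, fun h1 h2 => absurd ⟨h1, h2⟩ hφ⟩
  refine ⟨Q, fun ψ l => ?_, fun γ φ hφ hq => ?_⟩
  · obtain ⟨i, hi⟩ := hf (.inl (ψ, l))
    have := hQ i
    rw [hi] at this
    exact this
  · obtain ⟨i, hi⟩ := hf (.inr (γ, φ))
    obtain ⟨q, hqQ, hqF⟩ := hQ i
    rw [hi] at hqF
    exact ⟨q, hqQ, hqF hφ hq⟩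

theorem exists_lex_least (S : Set (Set ℤ)) (hS : S.Nonempty) (l : ℤ) (k : ℕ) :
    ∃ Z ∈ S, ∀ Z' ∈ S, Agree l (l + k) Z Z' ∨
      ∃ x, l ≤ x ∧ x < l + k ∧ x ∉ Z ∧ x ∈ Z' ∧ Agree l x Z Z' := by
  induction k with
  | zero =>
    obtain ⟨Z, hZ⟩ := hS
    exact ⟨Z, hZ, fun Z' _ => Or.inl fun x h1 h2 => by simp at h2; omega⟩
  | succ k ih =>
    obtain ⟨Z, hZ, hmin⟩ := ih
    have ext : ∀ {Y Z' : Set ℤ}, Agree l (l + k) Y Z' → (l + k ∈ Y ↔ l + k ∈ Z') →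
        Agree l (l + (k + 1 : ℕ)) Y Z' := by
      intro Y Z' h h' x h1 h2
      push_cast at h2
      rcases eq_or_ne x (l + k) with e | e
      · rw [e, h']
      · exact h x h1 (by omega)
    obtain ⟨Y, hY, hYZ, hlast⟩ : ∃ Y ∈ S, Agree l (l + k) Y Z ∧
        ∀ Z' ∈ S, Agree l (l + k) Y Z' → l + k ∈ Y → l + (k : ℤ) ∈ Z' := by
      by_cases h : ∃ Y ∈ S, Agree l (l + k) Y Z ∧ l + (k : ℤ) ∉ Y
      · obtain ⟨Y, hY, hYZ, hk⟩ := h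
        exact ⟨Y, hY, hYZ, fun _ _ _ h => absurd h hk⟩
      · push Not at h
        exact ⟨Z, hZ, fun _ _ _ => Iff.rfl, fun Z' hZ' h' _ =>
          h Z' hZ' fun x h1 h2 => (h' x h1 h2).symm⟩
    refine ⟨Y, hY, fun Z' hZ' => ?_⟩
    rcases hmin Z' hZ' with h | ⟨x, h1, h2, h3, h4, h5⟩
    · have hYZ' : Agree l (l + k) Y Z' := fun x h1 h2 => (hYZ x h1 h2).trans (h x h1 h2)
      by_cases hk : l + (k : ℤ) ∈ Y ↔ l + (k : ℤ) ∈ Z'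
      · exact Or.inl (ext hYZ' hk)
      · have := hlast Z' hZ' hYZ'
        exact Or.inr ⟨l + k, by omega, by push_cast; omega, by tauto, by tauto, hYZ'⟩
    · exact Or.inr ⟨x, h1, by push_cast; omega, by rwa [hYZ x h1 h2], h4,
        fun y h1' h2' => (hYZ y h1' (by omega)).trans (h5 y h1' h2')⟩

/-- Two conditions prescribe the same trace. -/
def Cond.Same (q r : Cond) : Prop := q.l = r.l ∧ q.u = r.u ∧ Agree q.l q.u q.Z r.Z

theorem Cond.Same.ext {q r : Cond} (h : q.Same r) : q.Ext r :=
  ⟨h.1.le, h.2.1.ge, fun x h1 h2 => h.2.2 x (h.1.trans_le h1) (h2.trans_eq h.2.1.symm)⟩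

theorem Cond.Same.symm {q r : Cond} (h : q.Same r) : r.Same q :=
  ⟨h.1.symm, h.2.1.symm, fun x h1 h2 =>
    (h.2.2 x (h.1.trans_le h1) (h2.trans_eq h.2.1.symm)).symm⟩

theorem exists_least {S : Cond → Prop} (hS : ∃ q, S q) {L U : ℤ}
    (hL : ∀ q, S q → q.l ≤ L) (hU : ∀ q, S q → U ≤ q.u) : ∃ q, Least S q := by
  obtain ⟨u, ⟨q, hq, rfl⟩, hu⟩ := Int.exists_least_of_bdd (P := fun u => ∃ q, S q ∧ q.u = u)
    ⟨U, by rintro _ ⟨q, hq, rfl⟩; exact hU q hq⟩ (hS.imp' _ fun q hq => ⟨q, hq, rfl⟩)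
  obtain ⟨l, ⟨r, hr, hru, rfl⟩, hl⟩ := Int.exists_greatest_of_bdd
    (P := fun l => ∃ r, S r ∧ r.u = q.u ∧ r.l = l)
    ⟨L, by rintro _ ⟨r, hr, _, rfl⟩; exact hL r hr⟩ ⟨q.l, q, hq, rfl, rfl⟩
  obtain ⟨Z, hZ, hmin⟩ := exists_lex_least {Z | S ⟨r.l, r.u, Z⟩} ⟨r.Z, hr⟩ r.l (r.u - r.l).toNat
  refine ⟨⟨r.l, r.u, Z⟩, hZ, fun s hs => ?_⟩
  rcases (hu s.u ⟨s, hs, rfl⟩).lt_or_eq with e | e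
  · exact Or.inl (hru.trans_lt e)
  · refine Or.inr ⟨hru.trans e, ?_⟩
    rcases (hl s.l ⟨s, hs, e.symm, rfl⟩).lt_or_eq with e' | e'
    · exact Or.inl e'
    · refine Or.inr ⟨e'.symm, ?_⟩
      have hs' : S ⟨r.l, r.u, s.Z⟩ := by rw [← e', hru, e]; exact hs
      have le : ∀ x, r.l ≤ x → (x < r.l + (r.u - r.l).toNat ↔ x < r.u) := by intro x hx; omega
      rcases hmin s.Z hs' with h | ⟨x, h1, h2, h3⟩
      · exact Or.inl fun x h1 h2 => h x h1 ((le x h1).2 h2)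
      · exact Or.inr ⟨x, h1, (le x h1).1 h2, h3⟩

theorem Least.same {S : Cond → Prop} {q r : Cond} (hq : Least S q) (hr : Least S r) :
    q.Same r := by
  have h1 := hq.2 r hr.1
  have h2 := hr.2 q hq.1
  unfold Precedes at h1 h2
  have hu : q.u = r.u := by omega
  have hl : q.l = r.l := by omega
  refine ⟨hl, hu, ?_⟩
  simp only [hu, hl, lt_irrefl, true_and, false_or] at h1 h2 ⊢
  rcases h1 with h1 | ⟨x, hx1, hx2, hx3, hx4, hx5⟩
  · exact h1
  · rcases h2 with h2 | ⟨y, hy1, hy2, hy3, hy4, hy5⟩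
    · exact fun z h1 h2' => (h2 z h1 h2').symm
    · rcases lt_trichotomy x y with e | e | e
      · exact absurd ((hy5 x hx1 e).1 hx4) hx3
      · subst e; exact absurd hy4 hx3
      · exact absurd ((hx5 y hy1 e).1 hy4) hy3

/-- Every integer is definable, by a formula in any first-order variable. -/
def AllDef (P : Fin n → Set ℤ) : Prop :=
  ∀ (z : ℤ) (i : ℕ), ∃ δ : MSO n, ∀ v V, ZSat P v V δ ↔ v i = z

theorem allDef_of_not_unb (h : ¬ Unb P) : AllDef P := by
  unfold Unb at h
  push Not at h
  obtain ⟨ψ, D, hψ, hD, hb⟩ := h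
  obtain ⟨d, hd, hmax⟩ := Int.exists_greatest_of_bdd (P := (· ∈ D)) hb hD
  have base : ∀ i : ℕ, ∃ δ : MSO n, ∀ v V, ZSat P v V δ ↔ v i = d := by
    have h5 : ∃ δ : MSO n, ∀ v V, ZSat P v V δ ↔ v 5 = d := by
      refine ⟨.and ψ (.all1 6 (.imp (.lt 5 6) (.not (.ex1 5 (.and (.eq 5 6) ψ))))),
        fun v V => ?_⟩
      simp only [Sat, sat_all1, sat_imp, sat_eq, hψ, Function.update_self, ne_eq,
        Nat.reduceEqDiff, not_false_eq_true, Function.update_of_ne, exists_eq_left]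
      constructor
      · rintro ⟨h1, h2⟩
        rcases (hmax _ h1).lt_or_eq with e | e
        · exact absurd hd (h2 d e)
        · exact e
      · intro h
        rw [h]
        exact ⟨hd, fun a ha hmem => absurd (hmax a hmem) ha.not_ge⟩
    intro i
    obtain ⟨δ, hδ⟩ := h5
    by_cases e : i = 5
    · subst e; exact ⟨δ, hδ⟩
    · exact ⟨.ex1 5 (.and (.eq 5 i) δ), fun v V => by simp [Sat, hδ, e]⟩
  intro z
  induction z using Int.inductionOn' (b := d) with
  | zero => exact base
  | succ k _ ih =>
    intro i
    obtain ⟨δ, hδ⟩ := ih (i + 1)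
    refine ⟨.ex1 (i + 1) (.and δ (.and (.lt (i + 1) i)
      (.not (.ex1 (i + 2) (.and (.lt (i + 1) (i + 2)) (.lt (i + 2) i)))))), fun v V => ?_⟩
    simp only [Sat, hδ, Function.update_self, exists_eq_left, ne_eq, Nat.left_eq_add,
      Nat.add_left_cancel_iff, not_false_eq_true, Function.update_of_ne, OfNat.ofNat_ne_zero,
      one_ne_zero, OfNat.one_ne_ofNat, not_exists]
    constructor
    · rintro ⟨h1, h2⟩
      have := h2 (k + 1)
      omega
    · intro h; exact ⟨by omega, fun x => by omega⟩
  | pred k _ ih =>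
    intro i
    obtain ⟨δ, hδ⟩ := ih (i + 1)
    refine ⟨.ex1 (i + 1) (.and δ (.and (.lt i (i + 1))
      (.not (.ex1 (i + 2) (.and (.lt i (i + 2)) (.lt (i + 2) (i + 1))))))), fun v V => ?_⟩
    simp only [Sat, hδ, Function.update_self, exists_eq_left, ne_eq, Nat.left_eq_add,
      Nat.add_left_cancel_iff, not_false_eq_true, Function.update_of_ne, OfNat.ofNat_ne_zero,
      one_ne_zero, OfNat.one_ne_ofNat, not_exists]
    constructor
    · rintro ⟨h1, h2⟩
      have := h2 (k - 1)
      omega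
    · intro h; exact ⟨by omega, fun x => by omega⟩

theorem AllDef.exists_sentence (h : AllDef P) (ψ : MSO (n + 1)) (l : List ℤ) :
    ∃ θ : MSO (n + 1), ∀ X, SatX P (close 0 θ) [] X ↔ SatX P ψ l X := by
  obtain ⟨ψ₀, hψ₀⟩ := Expressible.empty (p := n + 1) (R := fun P v V => ZSat P v V ψ)
    ⟨ψ, fun _ _ _ => Iff.rfl⟩
  have key : ∀ M, ∃ θ : MSO (n + 1), ∀ X v V,
      ZSat (Fin.snoc P X : Fin (n + 1) → Set ℤ) v V θ ↔
      ZSat (Fin.snoc P X : Fin (n + 1) → Set ℤ) (fun i => if i < M then asg l i else v i)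
        (fun _ => ∅) ψ := by
    intro M
    induction M with
    | zero => exact ⟨ψ₀, fun X v V => by simp [hψ₀]⟩
    | succ M ih =>
      obtain ⟨θ, hθ⟩ := ih
      obtain ⟨δ, hδ⟩ := h (asg l M) M
      refine ⟨.ex1 M (.and (lift δ) θ), fun X v V => ?_⟩
      simp only [Sat, sat_lift, hδ, Function.update_self, exists_eq_left, hθ]
      have : (fun i => if i < M then asg l i else Function.update v M (asg l M) i) =
          fun i => if i < M + 1 then asg l i else v i := by
        ext1 i
        rcases lt_trichotomy i M with e | e | e
        · simp [e, e.trans (Nat.lt_succ_self M)]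
        · simp [e]
        · simp [e.not_gt, e.ne', show ¬ i < M + 1 by omega]
      rw [this]
  obtain ⟨θ, hθ⟩ := key (encode ψ + 1)
  have hθ' : ∀ X v V, ZSat (Fin.snoc P X : Fin (n + 1) → Set ℤ) v V θ ↔ SatX P ψ l X := by
    intro X v V
    rw [hθ, SatX]
    refine sat_congr _ _ _ (fun i hi => ?_) fun _ _ => rfl
    have := le_encode_of_mem_fv1 ψ i hi
    simp [show i < encode ψ + 1 by omega]
  refine ⟨θ, fun X => ?_⟩
  rw [SatX, sat_close, hθ']
  intro v v' V V' _
  rw [hθ', hθ']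

/-- The conditions of the generic sequence. -/
def genSeq (P : Fin n → Set ℤ) (e : ℕ → MSO (n + 1)) (d : ℤ) : ℕ → Cond → Prop
  | 0 => fun q => q.l = d ∧ q.u = d
  | i + 1 => Least (Wider (genSeq P e d i) (SatX P (close 0 (e i)) []))

section genSeq

variable (P) (e : ℕ → MSO (n + 1)) (d : ℤ)

theorem genSeq_same : ∀ i q r, genSeq P e d i q → genSeq P e d i r → q.Same r
  | 0, q, r, hq, hr => ⟨hq.1.trans hr.1.symm, hq.2.trans hr.2.symm, fun x h1 h2 => by
      have := hq.1; have := hq.2; omega⟩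
  | _ + 1, _, _, hq, hr => Least.same hq hr

theorem exists_genSeq (i : ℕ) : ∃ q, genSeq P e d i q := by
  induction i with
  | zero => exact ⟨⟨d, d, ∅⟩, rfl, rfl⟩
  | succ i ih =>
    obtain ⟨q, hq⟩ := ih
    refine exists_least (L := q.l) (U := q.u) ?_ ?_ ?_
    · obtain ⟨r, hr, hd⟩ := exists_ext_decides (SatX P (close 0 (e i)) [])
        ⟨q.l - 1, q.u + 1, q.Z⟩
      have h1 := hr.1
      have h2 := hr.2.1
      simp only at h1 h2
      exact ⟨r, ⟨q, hq, by omega, by omega, hr.trans ⟨by simp only; omega, by simp only; omega,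
        fun _ _ _ => Iff.rfl⟩⟩, hd⟩
    · rintro r ⟨⟨s, hs, h1, -⟩, -⟩
      have := (genSeq_same P e d i _ _ hs hq).1
      omega
    · rintro r ⟨⟨s, hs, -, h1, -⟩, -⟩
      have := (genSeq_same P e d i _ _ hs hq).2.1
      omega

theorem exists_generic_of_genSeq (he : Function.Surjective e) (h : AllDef P) :
    ∃ Q, Generic P Q ∧ (∀ i q, genSeq P e d i q → q.In Q) ∧
      ∀ r : Cond, r.In Q → ∃ i q, genSeq P e d i q ∧ q.Ext r := by
  choose q hq using exists_genSeq P e d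
  have hext : ∀ i, (q (i + 1)).l < (q i).l ∧ (q i).u < (q (i + 1)).u ∧ (q (i + 1)).Ext (q i) := by
    intro i
    obtain ⟨⟨⟨s, hs, h1, h2, h3⟩, -⟩, -⟩ := hq (i + 1)
    have hsame := genSeq_same P e d i _ _ hs (hq i)
    exact ⟨hsame.1 ▸ h1, hsame.2.1 ▸ h2, h3.trans hsame.ext⟩
  have hwide : ∀ i : ℕ, (q i).l ≤ d - i ∧ d + i ≤ (q i).u := by
    intro i
    induction i with
    | zero => simp [(hq 0).1, (hq 0).2]
    | succ i ih => have := hext i; push_cast; omega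
  obtain ⟨Q, hQ⟩ := Cond.exists_in_of_chain fun i => (hext i).2.2
  refine ⟨Q, fun ψ l => ?_, fun i r hr => ?_, fun r hr => ?_⟩
  · obtain ⟨θ, hθ⟩ := h.exists_sentence ψ l
    obtain ⟨i, rfl⟩ := he θ
    refine ⟨q (i + 1), hQ (i + 1), ?_⟩
    have := (hq (i + 1)).1.2
    rwa [show SatX P (close 0 (e i)) [] = SatX P ψ l from funext fun X => propext (hθ X)] at this
  · exact (genSeq_same P e d i _ _ (hq i) hr).ext.in_of_in (hQ i)
  · obtain ⟨i, h1, h2⟩ : ∃ i : ℕ, d - i ≤ r.l ∧ r.u ≤ d + i :=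
      ⟨(d - r.l).toNat + (r.u - d).toNat, by push_cast; omega, by push_cast; omega⟩
    have hi := hwide i
    refine ⟨i, q i, hq i, by omega, by omega, fun x hx1 hx2 => ?_⟩
    exact (hQ i x (by omega) (by omega)).symm.trans (hr x hx1 hx2)

end genSeq

/-- A generic set together with formulas that locate its forcing conditions. -/
theorem exists_generic_locator (P : Fin n → Set ℤ) {e : ℕ → MSO (n + 1)}
    (he : Function.Surjective e) :
    ∃ (Q : Set ℤ) (σ : ℕ → MSO n) (S : ℕ → Cond → Prop), Generic P Q ∧
      (∀ i, fv1 (σ i) ⊆ {5, 6} ∧ fv2 (σ i) ⊆ {1}) ∧ (∀ i, DefinesCond P (σ i) (S i)) ∧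
      ((∀ i, σ (i + 1) = σ i) ∨ ∀ i, σ (i + 1) = stepF (σ i) (tr (close 0 (e i)))) ∧
      ∀ γ φ, φ.IsSentence →
        ((∃ q, q.In Q ∧ Frc P γ φ q) ↔ ∃ i q, S i q ∧ Frc P γ φ q) := by
  by_cases h : Unb P
  · obtain ⟨Q, hQ, hF⟩ := h.exists_generic he.countable
    refine ⟨Q, fun _ => .eq 5 5, fun _ _ => True, hQ, fun _ => ⟨?_, ?_⟩, fun _ v V => by simp,
      Or.inl fun _ => rfl, fun γ φ hφ => ⟨?_, ?_⟩⟩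
    · simp [fv1_eq]
    · simp [fv2_eq]
    · rintro ⟨q, -, hq⟩
      exact ⟨0, q, trivial, hq⟩
    · rintro ⟨-, q, -, hq⟩
      exact hF γ φ hφ ⟨q, hq⟩
  · have h := allDef_of_not_unb h
    obtain ⟨δ, hδ⟩ := h 0 0
    have hδ' : ∀ v V, ZSat P v V (close 1 δ) ↔ v 0 = 0 := by
      intro v V
      rw [sat_close, hδ]
      intro v v' V V' hv
      rw [hδ, hδ, hv 0 (by omega)]
    obtain ⟨Q, hQ, hin, hext⟩ := exists_generic_of_genSeq P e 0 he h
    let σ : ℕ → MSO n := fun i => Nat.rec (.and (.eq 5 6) (.ex1 0 (.and (.eq 0 5) (close 1 δ))))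
      (fun i σ => stepF σ (tr (close 0 (e i)))) i
    refine ⟨Q, σ, genSeq P e 0, hQ, fun i => ?_, fun i => ?_, Or.inr fun _ => rfl,
      fun γ φ hφ => ⟨?_, ?_⟩⟩
    · induction i with
      | zero =>
        refine ⟨fun x => ?_, ?_⟩
        · have := @lt_of_mem_fv1_close n 1 δ x
          simp only [σ, fv1, fv1_eq, Finset.mem_union, Finset.mem_sdiff, Finset.mem_insert,
            Finset.mem_singleton]
          grind
        · simp [σ, fv2, fv2_eq]
      | succ i ih =>
        exact ⟨fv1_stepF ih.1 (by simp), fv2_stepF ih.2 (fv2_tr_subset (by simp))⟩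
    · induction i with
      | zero =>
        intro v V
        simp only [σ, Sat, sat_eq, hδ', genSeq, Function.update_self, ne_eq, OfNat.ofNat_ne_zero,
          not_false_eq_true, Function.update_of_ne]
        constructor
        · rintro ⟨h1, a, h2, h3⟩; omega
        · rintro ⟨h1, h2⟩; exact ⟨by omega, 0, by omega, rfl⟩
      | succ i ih => exact definesCond_stepF ih (definesClass_tr P (isSentence_close _))
    · rintro ⟨r, hr, hF⟩
      obtain ⟨i, q, hq, hqr⟩ := hext r hr
      exact ⟨i, q, hq, hF.mono hqr⟩
    · rintro ⟨i, q, hq, hF⟩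
      exact ⟨q, hin i q hq, hF⟩

/-- Truth in a generic expansion is witnessed by a true sentence of the base structure. -/
theorem satX_iff_exists_searchF {Q : Set ℤ} {σ : ℕ → MSO n} {S : ℕ → Cond → Prop}
    (hQ : Generic P Q) (hσ : ∀ i, DefinesCond P (σ i) (S i))
    (hS : ∀ γ φ, φ.IsSentence →
        ((∃ q, q.In Q ∧ Frc P γ φ q) ↔ ∃ i q, S i q ∧ Frc P γ φ q))
    {φ : MSO (n + 1)} (hφ : φ.IsSentence) :
    SatX P φ [] Q ↔ ∃ i γ, TrueIn (fun x y : ℤ => x < y) P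
      (searchF (σ i) (tr (close 5 γ)) (tr φ)) := by
  have hA : ∀ i γ, TrueIn (fun x y : ℤ => x < y) P (searchF (σ i) (tr (close 5 γ)) (tr φ)) ↔
      ∃ q, S i q ∧ Frc P γ φ q := fun i γ => by
    simp only [TrueIn, sat_searchF (hσ i) (definesCond_frc P γ hφ), forall_const]
  simp only [hA]
  constructor
  · intro h
    obtain ⟨γ, a, b, c, d, q, hq, hF⟩ := hQ.exists_force hφ h
    obtain ⟨i, h⟩ := (hS γ φ hφ).1 ⟨q, hq, a, b, c, d, hF⟩
    exact ⟨i, γ, h⟩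
  · rintro ⟨i, γ, h⟩
    obtain ⟨q, hq, a, b, c, d, hF⟩ := (hS γ φ hφ).2 ⟨i, h⟩
    exact hQ.of_force hq hF

end

end Paper

namespace Paper

/-! ### Primitive recursive syntax -/

theorem unpair_snd_lt {c : ℕ} (h : c.unpair.1 ≠ 0) : c.unpair.2 < c := by
  conv_rhs => rw [← Nat.pair_unpair c, Nat.pair]
  have := Nat.pos_of_ne_zero h
  split_ifs <;> nlinarith

namespace MSO

variable {n : ℕ}

/-- The decoding function of the Gödel numbering; it is total, invalid codes being decoded
arbitrarily. -/
def dec (c : ℕ) : MSO n :=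
  if h0 : c.unpair.1 = 0 then .lt c.unpair.2.unpair.1 c.unpair.2.unpair.2
  else
    have := unpair_snd_lt h0
    have := Nat.unpair_left_le c.unpair.2
    have := Nat.unpair_right_le c.unpair.2
    if c.unpair.1 = 1 then
      if h : c.unpair.2.unpair.1 < n then .pred ⟨_, h⟩ c.unpair.2.unpair.2 else .lt 0 0
    else if c.unpair.1 = 2 then .mem c.unpair.2.unpair.1 c.unpair.2.unpair.2
    else if c.unpair.1 = 3 then .not (dec c.unpair.2)
    else if c.unpair.1 = 4 then .and (dec c.unpair.2.unpair.1) (dec c.unpair.2.unpair.2)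
    else if c.unpair.1 = 5 then .ex1 c.unpair.2.unpair.1 (dec c.unpair.2.unpair.2)
    else .ex2 c.unpair.2.unpair.1 (dec c.unpair.2.unpair.2)
termination_by c
decreasing_by all_goals omega

theorem dec_encode (φ : MSO n) : dec (encode φ) = φ := by
  induction φ <;> rw [dec] <;> simp_all [encode]

theorem primrec_comp_dec {h : MSO n → ℕ} {p : ℕ → ℕ → ℕ} {s : ℕ} (hp : Primrec₂ p)
    (hlt : ∀ i j, h (.lt i j) = Nat.pair 0 (Nat.pair i j)) (hpred : ∀ k i, h (.pred k i) = p k i)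
    (hmem : ∀ i j, h (.mem i j) = Nat.pair 2 (Nat.pair i (j + s)))
    (hnot : ∀ φ, h (.not φ) = Nat.pair 3 (h φ))
    (hand : ∀ φ ψ, h (.and φ ψ) = Nat.pair 4 (Nat.pair (h φ) (h ψ)))
    (hex1 : ∀ i φ, h (.ex1 i φ) = Nat.pair 5 (Nat.pair i (h φ)))
    (hex2 : ∀ j φ, h (.ex2 j φ) = Nat.pair 6 (Nat.pair (j + s) (h φ))) :
    Primrec fun c => h (dec c) := by
  let g : Unit → List ℕ → Option ℕ := fun _ l =>
    some (
      if l.length.unpair.1 = 0 then Nat.pair 0 l.length.unpair.2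
      else if l.length.unpair.1 = 1 then
        if l.length.unpair.2.unpair.1 < n then
          p l.length.unpair.2.unpair.1 l.length.unpair.2.unpair.2 else 0
      else if l.length.unpair.1 = 2 then
        Nat.pair 2 (Nat.pair l.length.unpair.2.unpair.1 (l.length.unpair.2.unpair.2 + s))
      else if l.length.unpair.1 = 3 then Nat.pair 3 (l.getD l.length.unpair.2 0)
      else if l.length.unpair.1 = 4 then
        Nat.pair 4 (Nat.pair (l.getD l.length.unpair.2.unpair.1 0)
          (l.getD l.length.unpair.2.unpair.2 0))
      else if l.length.unpair.1 = 5 then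
        Nat.pair 5 (Nat.pair l.length.unpair.2.unpair.1 (l.getD l.length.unpair.2.unpair.2 0))
      else Nat.pair 6 (Nat.pair (l.length.unpair.2.unpair.1 + s)
        (l.getD l.length.unpair.2.unpair.2 0)))
  have hg : Primrec₂ g := by
    have l : Primrec fun x : Unit × List ℕ => x.2 := Primrec.snd
    have c : Primrec fun x : Unit × List ℕ => x.2.length.unpair :=
      Primrec.unpair.comp (Primrec.list_length.comp l)
    have t := Primrec.fst.comp c
    have a := Primrec.snd.comp c
    have a1 := Primrec.fst.comp (Primrec.unpair.comp a)
    have a2 := Primrec.snd.comp (Primrec.unpair.comp a)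
    have look {f : Unit × List ℕ → ℕ} (hf : Primrec f) : Primrec fun x : Unit × List ℕ =>
        x.2.getD (f x) 0 :=
      (Primrec.list_getD 0).comp l hf
    have tag (k : ℕ) : PrimrecPred fun x : Unit × List ℕ => x.2.length.unpair.1 = k :=
      Primrec.eq.comp t (Primrec.const k)
    have pr {f g : Unit × List ℕ → ℕ} (hf : Primrec f) (hg : Primrec g) :
        Primrec fun x => Nat.pair (f x) (g x) := Primrec₂.natPair.comp hf hg
    have k (k : ℕ) : Primrec fun _ : Unit × List ℕ => k := Primrec.const k
    have shift {f : Unit × List ℕ → ℕ} (hf : Primrec f) : Primrec fun x => f x + s :=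
      Primrec.nat_add.comp hf (k s)
    exact Primrec.option_some.comp
      (Primrec.ite (tag 0) (pr (k 0) a)
      (Primrec.ite (tag 1) (Primrec.ite (Primrec.nat_lt.comp a1 (k n)) (hp.comp a1 a2) (k 0))
      (Primrec.ite (tag 2) (pr (k 2) (pr a1 (shift a2)))
      (Primrec.ite (tag 3) (pr (k 3) (look a))
      (Primrec.ite (tag 4) (pr (k 4) (pr (look a1) (look a2)))
      (Primrec.ite (tag 5) (pr (k 5) (pr a1 (look a2)))
      (pr (k 6) (pr (shift a1) (look a2)))))))))
  have := Primrec.nat_strong_rec (fun (_ : Unit) c => h (dec c)) hg fun _ c => by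
    by_cases h0 : c.unpair.1 = 0
    · rw [dec]; simp [g, h0, hlt]
    have e := unpair_snd_lt h0
    have e1 := (Nat.unpair_left_le c.unpair.2).trans_lt e
    have e2 := (Nat.unpair_right_le c.unpair.2).trans_lt e
    rw [dec]
    simp only [g, List.length_map, List.length_range, h0, if_false, dif_neg, not_false_eq_true,
      List.getD_eq_getElem?_getD, List.getElem?_map, List.getElem?_range, e, e1, e2,
      Option.map_some, Option.getD_some, Option.some.injEq]
    split_ifs <;> simp [hlt, hpred, hmem, hnot, hand, hex1, hex2, Nat.pair]
  exact this.comp (Primrec.const ()) Primrec.id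

theorem primrec_encode_dec : Primrec fun c => encode (dec c : MSO n) :=
  primrec_comp_dec (p := fun k i => Nat.pair 1 (Nat.pair k i)) (s := 0)
    (Primrec₂.natPair.comp (Primrec.const 1) Primrec₂.natPair) (fun _ _ => rfl) (fun _ _ => rfl)
    (fun _ _ => rfl) (fun _ => rfl) (fun _ _ => rfl) (fun _ _ => rfl) fun _ _ => rfl

instance : Primcodable (MSO n) where
  encode := encode
  decode c := some (dec c)
  encodek φ := congrArg some (dec_encode φ)
  prim := Primrec.nat_iff.1 (Primrec.succ.comp primrec_encode_dec)

theorem primrec_encode : Primrec (encode : MSO n → ℕ) := Primrec.encode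

theorem primrec_iff_encode {α : Type*} [Primcodable α] {f : α → MSO n} :
    Primrec f ↔ Primrec fun a => encode (f a) := Primrec.encode_iff.symm

theorem primrec_dec : Primrec (dec : ℕ → MSO n) := primrec_iff_encode.2 primrec_encode_dec

theorem primrec_tr : Primrec (tr : MSO (n + 1) → MSO n) := by
  rw [primrec_iff_encode]
  have h : Primrec fun c => encode (tr (dec c) : MSO n) :=
    primrec_comp_dec (h := fun φ => encode (tr φ)) (s := 1)
      (p := fun k i => if k < n then Nat.pair 1 (Nat.pair k i) else Nat.pair 2 (Nat.pair i 0))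
      (Primrec.ite (Primrec.nat_lt.comp Primrec.fst (Primrec.const n))
        (Primrec₂.natPair.comp (Primrec.const 1) Primrec₂.natPair)
        (Primrec₂.natPair.comp (Primrec.const 2)
          (Primrec₂.natPair.comp Primrec.snd (Primrec.const 0))))
      (fun _ _ => rfl) (fun k i => by simp only [tr]; split_ifs <;> rfl)
      (fun _ _ => rfl) (fun _ => rfl) (fun _ _ => rfl) (fun _ _ => rfl) fun _ _ => rfl
  simpa only [dec_encode] using h.comp (primrec_encode (n := n + 1))

section constructors

variable {α : Type*} [Primcodable α] {f g : α → MSO n} {i : α → ℕ}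

theorem primrec_not (hf : Primrec f) : Primrec fun a => MSO.not (f a) :=
  primrec_iff_encode.2 (Primrec₂.natPair.comp (Primrec.const 3) (primrec_encode.comp hf))

theorem primrec_and (hf : Primrec f) (hg : Primrec g) : Primrec fun a => MSO.and (f a) (g a) :=
  primrec_iff_encode.2 (Primrec₂.natPair.comp (Primrec.const 4)
    (Primrec₂.natPair.comp (primrec_encode.comp hf) (primrec_encode.comp hg)))

theorem primrec_ex1 (hi : Primrec i) (hf : Primrec f) : Primrec fun a => MSO.ex1 (i a) (f a) :=
  primrec_iff_encode.2 (Primrec₂.natPair.comp (Primrec.const 5)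
    (Primrec₂.natPair.comp hi (primrec_encode.comp hf)))

theorem primrec_ex2 (hi : Primrec i) (hf : Primrec f) : Primrec fun a => MSO.ex2 (i a) (f a) :=
  primrec_iff_encode.2 (Primrec₂.natPair.comp (Primrec.const 6)
    (Primrec₂.natPair.comp hi (primrec_encode.comp hf)))

theorem primrec_close (k : ℕ) : Primrec (close k : MSO n → MSO n) := by
  have hFO : Primrec₂ fun (φ : MSO n) m => closeFO k m φ :=
    (Primrec.nat_rec (f := id) (g := fun (_ : MSO n) (x : ℕ × MSO n) => MSO.ex1 (x.1 + k) x.2)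
      Primrec.id (primrec_ex1 (Primrec.nat_add.comp (Primrec.fst.comp Primrec.snd)
        (Primrec.const k)) (Primrec.snd.comp Primrec.snd))).of_eq fun φ m => by
      induction m with
      | zero => rfl
      | succ m ih => simp only [closeFO, ← ih]
  have hSO : Primrec₂ fun (φ : MSO n) m => closeSO m φ :=
    (Primrec.nat_rec (f := id) (g := fun (_ : MSO n) (x : ℕ × MSO n) => MSO.ex2 x.1 x.2)
      Primrec.id (primrec_ex2 (Primrec.fst.comp Primrec.snd)
        (Primrec.snd.comp Primrec.snd))).of_eq fun φ m => by
      induction m with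
      | zero => rfl
      | succ m ih => simp only [closeSO, ← ih]
  have h1 : Primrec fun φ : MSO n => encode φ + 1 := Primrec.succ.comp primrec_encode
  exact hSO.comp (hFO.comp Primrec.id h1) h1

theorem primrec_searchF {σ : α → MSO n} (hσ : Primrec σ) (hf : Primrec f) (hg : Primrec g) :
    Primrec fun a => searchF (σ a) (f a) (g a) := by
  unfold searchF frcF forceF MSO.all1 MSO.all2 MSO.imp
  repeat' first
    | assumption
    | exact Primrec.const _
    | apply primrec_not
    | apply primrec_and
    | apply primrec_ex1
    | apply primrec_ex2

theorem primrec_stepF (hf : Primrec f) (hg : Primrec g) :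
    Primrec fun a => stepF (f a) (g a) := by
  unfold stepF leastF widerF decidesF shiftF MSO.all1 MSO.all2 MSO.imp MSO.or
  repeat' first
    | assumption
    | exact Primrec.const _
    | apply primrec_not
    | apply primrec_and
    | apply primrec_ex1
    | apply primrec_ex2

end constructors

end MSO

/-! ### Computability relative to an oracle -/

section oracle

variable {O : ℕ →. ℕ}

theorem RecursiveIn.of_eq {f g : ℕ →. ℕ} (hf : RecursiveIn O f) (h : ∀ x, f x = g x) :
    RecursiveIn O g := (funext h : f = g) ▸ hf

/-- The total function `f` is recursive in the oracle `O`. -/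
def TotalIn (O : ℕ →. ℕ) (f : ℕ → ℕ) : Prop := RecursiveIn O fun x => Part.some (f x)

theorem TotalIn.comp {f g : ℕ → ℕ} (hf : TotalIn O f) (hg : TotalIn O g) :
    TotalIn O fun x => f (g x) :=
  (RecursiveIn.comp hf hg).of_eq fun x => by simp

theorem TotalIn.pair {f g : ℕ → ℕ} (hf : TotalIn O f) (hg : TotalIn O g) :
    TotalIn O fun x => Nat.pair (f x) (g x) :=
  (RecursiveIn.pair hf hg).of_eq fun x => by simp [Seq.seq]

theorem totalIn_of_primrec {f : ℕ → ℕ} (hf : Nat.Primrec f) : TotalIn O f := by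
  induction hf with
  | zero => exact RecursiveIn.zero
  | succ => exact RecursiveIn.succ
  | left => exact RecursiveIn.left
  | right => exact RecursiveIn.right
  | pair _ _ h1 h2 => exact h1.pair h2
  | comp _ _ h1 h2 => exact h1.comp h2
  | prec _ _ h1 h2 =>
    refine (RecursiveIn.prec h1 h2).of_eq fun x => ?_
    simp only [Nat.unpaired]
    induction x.unpair.2 with
    | zero => rfl
    | succ m ih =>
      simp only at ih ⊢
      rw [ih]
      simp

theorem TotalIn.comp₂ {h : ℕ → ℕ → ℕ} {f g : ℕ → ℕ} (hh : Primrec₂ h) (hf : TotalIn O f)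
    (hg : TotalIn O g) : TotalIn O fun x => h (f x) (g x) := by
  simpa using (totalIn_of_primrec (Primrec₂.unpaired'.2 hh)).comp (hf.pair hg)

theorem RecursiveIn.partrec (hO : Nat.Partrec O) {f : ℕ →. ℕ} (hf : RecursiveIn O f) :
    Nat.Partrec f := by
  induction hf with
  | zero => exact .zero
  | succ => exact .succ
  | left => exact .left
  | right => exact .right
  | oracle => exact hO
  | pair _ _ h1 h2 => exact .pair h1 h2
  | comp _ _ h1 h2 => exact .comp h1 h2
  | prec _ _ h1 h2 => exact .prec h1 h2
  | rfind _ h => exact .rfind h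

open Classical in
theorem decidableSet_iff_partrec_chi {S : Set ℕ} : DecidableSet S ↔ Nat.Partrec (chi S) := by
  constructor
  · rintro ⟨_, h⟩
    refine (Partrec.nat_iff.1 (Computable.cond h (Computable.const 1) (Computable.const 0)).partrec
      ).of_eq fun x => ?_
    by_cases hx : x ∈ S <;> simp [chi, hx]
  · intro h
    refine ⟨Classical.decPred _, ?_⟩
    have h' : Computable fun x => S.indicator (fun _ => 1) x := Partrec.nat_iff.2 h
    refine ((Primrec.eq (α := ℕ)).decide.to_comp.comp h' (Computable.const 1)).of_eq fun x => ?_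
    by_cases hx : x ∈ S <;> simp [hx]

theorem DecidableSet.of_turingRed {S T : Set ℕ} (h : TuringRed S T) (hT : DecidableSet T) :
    DecidableSet S :=
  decidableSet_iff_partrec_chi.2 (h.partrec (decidableSet_iff_partrec_chi.1 hT))

/-- A set is recursive in `T` if, within a domain reducible to `T`, both the set and its
complement are enumerable relative to `T`. -/
theorem turingRed_of_search {S T : Set ℕ} {D : ℕ → ℕ} {A B : ℕ → ℕ → ℕ} (hD : Primrec D)
    (hA : Primrec₂ A) (hB : Primrec₂ B) (hS : ∀ c, c ∈ S ↔ D c ∈ T ∧ ∃ m, A c m ∈ T)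
    (hSc : ∀ c, D c ∈ T → c ∉ S → ∃ m, B c m ∈ T) (hAB : ∀ c, D c ∈ T → ∀ m, B c m ∈ T → c ∉ S) :
    TuringRed S T := by
  classical
  let χ : ℕ → ℕ := fun x => if x ∈ T then 1 else 0
  have hχ : TotalIn (chi T) χ := RecursiveIn.oracle.of_eq fun x => by
    simp only [chi, χ, Set.indicator_apply]
  have hl : TotalIn (chi T) fun x => x.unpair.1 := RecursiveIn.left
  have hr : TotalIn (chi T) fun x => x.unpair.2 := RecursiveIn.right
  have hD' : TotalIn (chi T) fun x => χ (D x.unpair.1) :=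
    hχ.comp ((totalIn_of_primrec (Primrec.nat_iff.1 hD)).comp hl)
  have hA' : TotalIn (chi T) fun x => χ (A x.unpair.1 x.unpair.2) :=
    hχ.comp (TotalIn.comp₂ hA hl hr)
  have hB' : TotalIn (chi T) fun x => χ (B x.unpair.1 x.unpair.2) :=
    hχ.comp (TotalIn.comp₂ hB hl hr)
  have hF : TotalIn (chi T) fun x => χ (D x.unpair.1) -
      (χ (A x.unpair.1 x.unpair.2) + χ (B x.unpair.1 x.unpair.2)) :=
    TotalIn.comp₂ Primrec.nat_sub hD' (TotalIn.comp₂ Primrec.nat_add hA' hB')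
  have hG : TotalIn (chi T) fun x => χ (D x.unpair.1) * χ (A x.unpair.1 x.unpair.2) :=
    TotalIn.comp₂ Primrec.nat_mul hD' hA'
  have id' : TotalIn (chi T) fun x => x := totalIn_of_primrec (Primrec.nat_iff.1 Primrec.id)
  refine (RecursiveIn.comp hG (RecursiveIn.pair id' (RecursiveIn.rfind hF))).of_eq fun c => ?_
  have hex : ∃ m, χ (D c) - (χ (A c m) + χ (B c m)) = 0 := by
    by_cases h : D c ∈ T
    · by_cases hc : c ∈ S
      · obtain ⟨m, hm⟩ := ((hS c).1 hc).2
        exact ⟨m, by simp [χ, h, hm]⟩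
      · obtain ⟨m, hm⟩ := hSc c h hc
        exact ⟨m, by simp [χ, h, hm]⟩
    · exact ⟨0, by simp [χ, h]⟩
  obtain ⟨m, hm⟩ : ∃ m, m ∈ Nat.rfind fun m => (fun x => decide (x = 0)) <$>
      (Part.some (χ (D c) - (χ (A c m) + χ (B c m)))) := by
    obtain ⟨m, hm⟩ := hex
    exact Part.dom_iff_mem.1 (Nat.rfind_dom.2 ⟨m, by simp [hm], fun _ => trivial⟩)
  have h0 := Nat.rfind_spec hm
  simp only [Part.map_eq_map, Part.map_some, Part.mem_some_iff, eq_comm (a := true),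
    decide_eq_true_eq] at h0
  have hm' := Part.eq_some_iff.2 hm
  simp only [Nat.unpair_pair]
  rw [hm']
  simp only [Part.map_eq_map, Part.map_some, Seq.seq, Part.bind_eq_bind, Part.bind_some,
    Nat.unpair_pair, chi, Set.indicator_apply]
  congr 1
  by_cases h : D c ∈ T
  · by_cases hA : A c m ∈ T
    · simp [χ, h, hA, (hS c).2 ⟨h, m, hA⟩]
    · have hB : B c m ∈ T := by
        by_contra hB
        simp [χ, h, hA, hB] at h0
      simp [χ, hA, hAB c h m hB]
  · have : c ∉ S := fun hc => h ((hS c).1 hc).1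
    simp [χ, h, this]

end oracle

end Paper

namespace Paper

/-! ### The theory of the expansion by a generic set -/

open MSO

variable {n : ℕ}

theorem encode_mem_theoryCodes {A : Type} {r : A → A → Prop} {P : Fin n → Set A} {φ : MSO n} :
    encode φ ∈ TheoryCodes r P ↔ φ.IsSentence ∧ TrueIn r P φ := by
  constructor
  · rintro ⟨ψ, h1, h2, h3⟩
    rw [← dec_encode φ, ← h2, dec_encode]
    exact ⟨h1, h3⟩
  · exact fun h => ⟨φ, h.1, rfl, h.2⟩

theorem trueIn_snoc_iff_satX {P : Fin n → Set ℤ} {Q : Set ℤ} {φ : MSO (n + 1)}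
    (hφ : φ.IsSentence) : TrueIn (fun x y : ℤ => x < y) (Fin.snoc P Q) φ ↔ SatX P φ [] Q :=
  ⟨fun h => h _ _, fun h _ _ =>
    (sat_congr _ _ φ (fun i hi => by simp [hφ.1] at hi) fun i hi => by simp [hφ.2] at hi).1 h⟩

/-- A formula which is a true sentence precisely when `φ` is a sentence. -/
def sentenceTest (φ : MSO (n + 1)) : MSO n := .ex2 0 (tr (.not (.and φ (.not φ))))

theorem isSentence_and_trueIn_sentenceTest {A : Type} {r : A → A → Prop} {P : Fin n → Set A}
    {φ : MSO (n + 1)} :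
    (sentenceTest φ).IsSentence ∧ TrueIn r P (sentenceTest φ) ↔ φ.IsSentence := by
  have ht : TrueIn r P (sentenceTest φ) := fun v V => by simp [sentenceTest, tr, Sat]
  have h2 : fv2 (sentenceTest φ) = ∅ ↔ fv2 φ = ∅ := by
    simp only [Finset.eq_empty_iff_forall_notMem, ← succ_mem_fv2_tr]
    simp only [sentenceTest, tr, fv2, Finset.union_self, Finset.mem_sdiff,
      Finset.mem_singleton, not_and, not_not]
    refine ⟨fun h j hj => absurd (h _ hj) (by simp), fun h j hj => ?_⟩
    cases j with
    | zero => rfl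
    | succ j => exact absurd hj (h j)
  have h1 : fv1 (sentenceTest φ) = fv1 φ := by simp [sentenceTest, tr, fv1]
  rw [IsSentence, IsSentence, h1, h2, and_iff_left ht]

theorem turingRed_theoryCodes_snoc {P : Fin n → Set ℤ} {Q : Set ℤ} {σ : ℕ → MSO n}
    (hσ : Primrec σ) (hfv : ∀ i, fv1 (σ i) ⊆ {5, 6} ∧ fv2 (σ i) ⊆ {1})
    (h : ∀ φ : MSO (n + 1), φ.IsSentence → (SatX P φ [] Q ↔ ∃ i γ,
      TrueIn (fun x y : ℤ => x < y) P (searchF (σ i) (tr (close 5 γ)) (tr φ)))) :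
    TuringRed (TheoryCodes (fun x y : ℤ => x < y) (Fin.snoc P Q))
      (TheoryCodes (fun x y : ℤ => x < y) P) := by
  let D : ℕ → ℕ := fun c =>
    if encode (dec c : MSO (n + 1)) = c then encode (sentenceTest (dec c : MSO (n + 1))) else 0
  let F : MSO (n + 1) → ℕ → MSO n := fun φ m =>
    searchF (σ m.unpair.1) (tr (close 5 (dec m.unpair.2))) (tr φ)
  have hdec : Primrec (dec : ℕ → MSO (n + 1)) := primrec_dec
  have hF : Primrec₂ F :=
    primrec_searchF (hσ.comp (Primrec.fst.comp (Primrec.unpair.comp Primrec.snd)))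
      (primrec_tr.comp ((primrec_close 5).comp
        (hdec.comp (Primrec.snd.comp (Primrec.unpair.comp Primrec.snd)))))
      (primrec_tr.comp Primrec.fst)
  have hD : Primrec D :=
    Primrec.ite (Primrec.eq.comp primrec_encode_dec Primrec.id)
      (primrec_encode.comp (primrec_ex2 (Primrec.const 0)
        (primrec_tr.comp (primrec_not (primrec_and hdec (primrec_not hdec)))))) (Primrec.const 0)
  have memD : ∀ c, D c ∈ TheoryCodes (fun x y : ℤ => x < y) P ↔
      ∃ φ : MSO (n + 1), φ.IsSentence ∧ encode φ = c := by
    intro c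
    simp only [D]
    split_ifs with hc
    · rw [encode_mem_theoryCodes, isSentence_and_trueIn_sentenceTest]
      refine ⟨fun h => ⟨_, h, hc⟩, ?_⟩
      rintro ⟨φ, h, rfl⟩
      rwa [dec_encode]
    · constructor
      · rw [show (0 : ℕ) = encode (.lt 0 0 : MSO n) from rfl, encode_mem_theoryCodes]
        rintro ⟨⟨h, -⟩, -⟩
        simp [fv1] at h
      · rintro ⟨φ, h, rfl⟩
        exact absurd (by rw [dec_encode]) hc
  have key : ∀ φ : MSO (n + 1), φ.IsSentence →
      (SatX P φ [] Q ↔ ∃ m, encode (F φ m) ∈ TheoryCodes (fun x y : ℤ => x < y) P) := by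
    intro φ hφ
    have hs : ∀ m, (F φ m).IsSentence := fun m =>
      isSentence_searchF (hfv _).1 (hfv _).2
        (fun i hi => lt_of_mem_fv1_close (fv1_tr (close 5 _) ▸ hi))
        (fv2_tr_subset (fv2_close _ _)) (by rw [fv1_tr, hφ.1]) (fv2_tr_subset hφ.2)
    simp only [encode_mem_theoryCodes, hs, true_and, h φ hφ]
    constructor
    · rintro ⟨i, γ, hi⟩
      exact ⟨Nat.pair i (encode γ), by simpa [F, dec_encode] using hi⟩
    · rintro ⟨m, hm⟩
      exact ⟨_, _, hm⟩
  refine turingRed_of_search (A := fun c m => encode (F (dec c) m))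
    (B := fun c m => encode (F (.not (dec c)) m)) hD
    (primrec_encode.comp (hF.comp (hdec.comp Primrec.fst) Primrec.snd))
    (primrec_encode.comp (hF.comp (primrec_not (hdec.comp Primrec.fst)) Primrec.snd))
    (fun c => ?_) (fun c hc hcS => ?_) fun c hc m hm => ?_
  · rw [memD]
    constructor
    · rintro ⟨φ, hφ, rfl, ht⟩
      rw [dec_encode, ← key φ hφ, ← trueIn_snoc_iff_satX hφ]
      exact ⟨⟨φ, hφ, rfl⟩, ht⟩
    · rintro ⟨⟨φ, hφ, rfl⟩, hm⟩
      rw [dec_encode, ← key φ hφ, ← trueIn_snoc_iff_satX hφ] at hm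
      exact ⟨φ, hφ, rfl, hm⟩
  · obtain ⟨φ, hφ, rfl⟩ := (memD c).1 hc
    rw [encode_mem_theoryCodes, trueIn_snoc_iff_satX hφ] at hcS
    rw [dec_encode, ← key (.not φ) hφ]
    exact fun h => hcS ⟨hφ, h⟩
  · obtain ⟨φ, hφ, rfl⟩ := (memD c).1 hc
    rw [dec_encode] at hm
    rw [encode_mem_theoryCodes, trueIn_snoc_iff_satX hφ]
    exact fun h => (key (.not φ) hφ).2 ⟨m, hm⟩ h.2

theorem primrec_of_step {σ : ℕ → MSO n} (h : (∀ i, σ (i + 1) = σ i) ∨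
    ∀ i, σ (i + 1) = stepF (σ i) (tr (close 0 (dec i)))) : Primrec σ := by
  rcases h with h | h
  · refine (Primrec.const (σ 0)).of_eq fun i => ?_
    induction i with
    | zero => rfl
    | succ i ih => rw [h, ← ih]
  · have hg : Primrec₂ fun (i : ℕ) (τ : MSO n) => stepF τ (tr (close 0 (dec i))) :=
      primrec_stepF Primrec.snd
        (primrec_tr.comp ((primrec_close 0).comp (primrec_dec.comp Primrec.fst)))
    refine (Primrec.nat_rec₁ (σ 0) hg).of_eq fun i => ?_
    induction i with
    | zero => rfl
    | succ i ih => simp only [h, ← ih]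

end Paper

/-- For every labelled linear ordering `M = (ℤ, <, P₁, …, Pₙ)` there is a set
`Q ⊆ ℤ`, not MSO-definable in `M`, such that the MSO theory of the expansion
`M' = (ℤ, <, P₁, …, Pₙ, Q)` is recursive in the MSO theory of `M`; in
particular if `MSO(M)` is decidable then so is `MSO(M')`. -/
theorem stmt_14 {n : ℕ} (P : Fin n → Set ℤ) :
    ∃ Q : Set ℤ,
      ¬ MSO.Definable (fun x y : ℤ => x < y) P Q ∧
      TuringRed (MSO.TheoryCodes (fun x y : ℤ => x < y) (Fin.snoc P Q))
        (MSO.TheoryCodes (fun x y : ℤ => x < y) P) ∧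
      (DecidableSet (MSO.TheoryCodes (fun x y : ℤ => x < y) P) →
        DecidableSet (MSO.TheoryCodes (fun x y : ℤ => x < y) (Fin.snoc P Q))) := by
  obtain ⟨Q, σ, S, hQ, hfv, hσ, hstep, hS⟩ := exists_generic_locator P (e := MSO.dec)
    fun φ => ⟨φ.encode, MSO.dec_encode φ⟩
  have h := turingRed_theoryCodes_snoc (primrec_of_step hstep) hfv fun φ hφ =>
    satX_iff_exists_searchF hQ hσ hS hφ
  exact ⟨Q, hQ.not_definable, h, .of_turingRed h⟩
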